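/- Let φ be a root of t³ + t + 1 = 0 and K₀ = ℚ(φ), and take ψ = φ². The cubic surface X ⊂ P³_ℚ defined by N_{K₀/ℚ}(x + φz + φ²w) = 5²·7·y·(x + θy)(x + θ̄y), where θ, θ̄ are the roots of T² − 4T + 35 (so the equation reads ∏_{i=0}^{2}(x + φ_i z + φ_i² w) = 175·y·(x² + 4xy + 35y²) over ℚ), fails the Hasse principle: it has a nontrivial solution over ℝ and over ℚ_p for every prime p, but no nontrivial solution over ℚ. -/

import Mathlib

/-- The ring of integers `ℤ[ω]`, `ω² = ω - 8`, of `ℚ(√-31)`. -/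
abbrev IntQuad31 : Type := QuadraticAlgebra ℤ (-8) 1

/-- The imaginary quadratic field `ℚ(√-31)`. -/
abbrev Quad31 : Type := QuadraticAlgebra ℚ (-8) 1

namespace IntQuad31

open QuadraticAlgebra

instance : Fact (∀ r : ℚ, r ^ 2 ≠ -8 + 1 * r) :=
  ⟨fun r h => by nlinarith [sq_nonneg (r - 1 / 2)]⟩

lemma norm_eq (z : IntQuad31) : z.norm = z.re ^ 2 + z.re * z.im + 8 * z.im ^ 2 := by
  rw [norm_def]; ring

/-- The inclusion of `ℤ[ω]` in its field of fractions. -/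
def toField : IntQuad31 →+* Quad31 where
  toFun z := ⟨z.re, z.im⟩
  map_zero' := by ext <;> simp
  map_one' := by ext <;> simp
  map_add' _ _ := by ext <;> simp
  map_mul' _ _ := by ext <;> simp

lemma toField_injective : Function.Injective toField := by
  intro z w h
  have h1 := congrArg QuadraticAlgebra.re h
  have h2 := congrArg QuadraticAlgebra.im h
  simp only [toField, RingHom.coe_mk, MonoidHom.coe_mk, OneHom.coe_mk, Int.cast_inj] at h1 h2
  exact QuadraticAlgebra.ext h1 h2

instance : IsDomain IntQuad31 := toField_injective.isDomain _

instance : Algebra IntQuad31 Quad31 := toField.toAlgebra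

lemma isIntegral_int (z : IntQuad31) : IsIntegral ℤ z := Algebra.IsIntegral.isIntegral z

lemma exists_int_of_isIntegral_cast {z : Quad31} (hz : IsIntegral ℤ z) (him : z.im = 0) :
    ∃ n : ℤ, z.re = n := by
  have h : z = algebraMap ℚ Quad31 z.re := by ext <;> simp [him]
  rw [h, isIntegral_algebraMap_iff (algebraMap ℚ Quad31).injective] at hz
  obtain ⟨n, hn⟩ := IsIntegrallyClosed.isIntegral_iff.mp hz
  exact ⟨n, by rw [← hn]; simp⟩

lemma exists_of_isIntegral {z : Quad31} (hz : IsIntegral ℤ z) : ∃ w, toField w = z := by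
  have hs : IsIntegral ℤ (star z) := by
    have := hz.map ((starRingEnd Quad31).toIntAlgHom)
    exact this
  obtain ⟨t, ht⟩ := exists_int_of_isIntegral_cast (hz.add hs) (by simp)
  obtain ⟨n, hn⟩ := exists_int_of_isIntegral_cast (hz.mul hs) (by simp; ring)
  simp at ht hn
  obtain ⟨k, hk⟩ : ∃ k : ℤ, 31 * z.im = k := by
    have h : IsIntegral ℤ (31 * z.im) := by
      refine IsIntegral.of_pow (n := 2) (by norm_num) ?_
      have : (31 * z.im) ^ 2 = ((31 * (4 * n - t ^ 2) : ℤ) : ℚ) := by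
        push_cast; rw [← ht, ← hn]; ring
      rw [this]
      exact isIntegral_algebraMap (R := ℤ) (A := ℚ)
    obtain ⟨k, hk⟩ := IsIntegrallyClosed.isIntegral_iff.mp h
    exact ⟨k, by rw [← hk]; simp⟩
  have hkt : k ^ 2 = 31 * (4 * n - t ^ 2) := by
    have : (k : ℚ) ^ 2 = 31 * (4 * n - t ^ 2) := by rw [← hk, ← ht, ← hn]; ring
    exact_mod_cast this
  obtain ⟨b, rfl⟩ : (31 : ℤ) ∣ k :=
    (Int.prime_iff_natAbs_prime.mpr (by norm_num)).dvd_of_dvd_pow ⟨_, hkt⟩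
  have hb : z.im = b := by push_cast at hk; linarith
  have h4 : 31 * b ^ 2 + t ^ 2 = 4 * n := by nlinarith
  obtain ⟨a, ha⟩ : (2 : ℤ) ∣ t - b := by
    have : Even (31 * b ^ 2 + t ^ 2) := ⟨2 * n, by linarith⟩
    have h31 : ¬ Even (31 : ℤ) := by decide
    have h2 : Even (t - b) := by
      rw [Int.even_add, Int.even_mul, Int.even_pow' two_ne_zero, Int.even_pow' two_ne_zero] at this
      rw [Int.even_sub]
      tauto
    exact h2.two_dvd
  refine ⟨⟨a, b⟩, ?_⟩
  ext
  · have : ((t - b : ℤ) : ℚ) = 2 * a := by exact_mod_cast ha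
    push_cast at this
    simp [toField]; linarith
  · simp [toField, hb]

instance : IsIntegralClosure IntQuad31 ℤ Quad31 where
  algebraMap_injective := toField_injective
  isIntegral_iff {z} := by
    refine ⟨exists_of_isIntegral, ?_⟩
    rintro ⟨w, rfl⟩
    exact (isIntegral_int w).map toField.toIntAlgHom

instance : IsDedekindDomain IntQuad31 :=
  IsIntegralClosure.isDedekindDomain ℤ ℚ Quad31 IntQuad31

lemma absNorm_span (z : IntQuad31) : Ideal.absNorm (Ideal.span {z}) = z.norm.natAbs := by
  rw [Ideal.absNorm_span_singleton, Algebra.norm_apply, ← det_toLinearMap_eq_norm]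
  rfl

/-- The ring homomorphism from `ℤ[ω]` sending `ω` to a given root of `T² - T + 8`. -/
def homOfRoot {A : Type*} [CommRing A] (u : A) (hu : u * u = -8 + u) : IntQuad31 →+* A :=
  (QuadraticAlgebra.lift ⟨u, by simpa using hu⟩ : IntQuad31 →ₐ[ℤ] A).toRingHom

lemma homOfRoot_apply {A : Type*} [CommRing A] (u : A) (hu : u * u = -8 + u) (z : IntQuad31) :
    homOfRoot u hu z = z.re + z.im * u := by
  simp [homOfRoot]

end IntQuad31

/-- The norm form `N(x + φ z + φ² w)` of the cubic field generated by a root `φ` of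
`t³ + t + 1`. -/
def cubicNorm {R : Type*} [CommRing R] (x z w : R) : R :=
  x ^ 3 - 2 * x ^ 2 * w + x * z ^ 2 + 3 * x * z * w + x * w ^ 2 - z ^ 3 - z * w ^ 2 + w ^ 3

lemma map_cubicNorm {R S : Type*} [CommRing R] [CommRing S] (f : R →+* S) (x z w : R) :
    f (cubicNorm x z w) = cubicNorm (f x) (f z) (f w) := by
  simp [cubicNorm, map_ofNat]

lemma cubicNorm_smul {R : Type*} [CommRing R] (s x z w : R) :
    cubicNorm (s * x) (s * z) (s * w) = s ^ 3 * cubicNorm x z w := by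
  unfold cubicNorm; ring

/-- `t³ + t + 1` has no root in `R`. -/
def CubicRootless (R : Type*) [CommRing R] : Prop := ∀ t : R, t ^ 3 + t + 1 ≠ 0

lemma CubicRootless.eq_zero_of_cubicNorm_eq_zero {F : Type*} [Field F] (hF : CubicRootless F)
    {a b c : F} (h : cubicNorm a b c = 0) : a = 0 ∧ b = 0 ∧ c = 0 := by
  by_cases hc : c = 0
  · subst hc
    by_cases hb : b = 0
    · subst hb
      have : a ^ 3 = 0 := by rw [← h]; unfold cubicNorm; ring
      exact ⟨by simpa using this, rfl, rfl⟩
    · refine absurd ?_ (hF (-a / b))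
      have : a ^ 3 + a * b ^ 2 - b ^ 3 = 0 := by rw [← h]; unfold cubicNorm; ring
      field_simp
      linear_combination -this
  · exfalso
    set r₁ := c ^ 2 + b ^ 2 - a * c with hr₁
    set r₀ := c ^ 2 + a * b with hr₀
    have key : a * r₁ ^ 2 - b * r₀ * r₁ + c * r₀ ^ 2 = c ^ 2 * cubicNorm a b c := by
      rw [hr₁, hr₀]; unfold cubicNorm; ring
    have hdiv : ∀ t : F, c ^ 2 * (t ^ 3 + t + 1)
        = (a + b * t + c * t ^ 2) * (c * t - b) + r₁ * t + r₀ := by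
      intro t; rw [hr₁, hr₀]; ring
    rw [h, mul_zero] at key
    have hroot : ∃ t : F, c ^ 2 * (t ^ 3 + t + 1) = 0 := by
      by_cases h1 : r₁ = 0
      · have h0 : r₀ = 0 := by
          have : c * r₀ ^ 2 = 0 := by rw [h1] at key; linear_combination key
          simpa [hc] using this
        refine ⟨b / c, ?_⟩
        rw [hdiv, h0, h1]
        field_simp
        ring
      · refine ⟨-r₀ / r₁, ?_⟩
        rw [hdiv]
        have : a + b * (-r₀ / r₁) + c * (-r₀ / r₁) ^ 2 = 0 := by
          field_simp
          linear_combination key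
        rw [this]
        field_simp
        ring
    obtain ⟨t, ht⟩ := hroot
    exact hF t (by simpa [hc] using ht)

section Dedekind

open UniqueFactorizationMonoid

variable {R : Type*} [CommRing R] [IsDedekindDomain R]

open Classical in
/-- The exponent of the prime ideal `P` in the factorization of the ideal generated by `b`. -/
noncomputable def ordAt (P : Ideal R) (b : R) : ℕ :=
  (normalizedFactors (Ideal.span {b})).count P

lemma mem_pow_iff_le_ordAt {P : Ideal R} (hP : P.IsPrime) (hP0 : P ≠ ⊥) {b : R} (hb : b ≠ 0)
    (n : ℕ) : b ∈ P ^ n ↔ n ≤ ordAt P b := by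
  classical
  have hb' : Ideal.span {b} ≠ 0 := by simpa using hb
  have hirr : Irreducible P := (Ideal.prime_of_isPrime hP0 hP).irreducible
  rw [← Ideal.span_singleton_le_iff_mem, ← Ideal.dvd_iff_le,
    pow_dvd_iff_le_emultiplicity, emultiplicity_eq_count_normalizedFactors hirr hb',
    normalize_eq, Nat.cast_le, ordAt]

lemma ordAt_mul (P : Ideal R) {a b : R} (ha : a ≠ 0) (hb : b ≠ 0) :
    ordAt P (a * b) = ordAt P a + ordAt P b := by
  classical
  rw [ordAt, ← Ideal.span_singleton_mul_span_singleton, normalizedFactors_mul (by simpa using ha)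
    (by simpa using hb), Multiset.count_add]
  rfl

lemma ordAt_pow (P : Ideal R) {a : R} (ha : a ≠ 0) (n : ℕ) :
    ordAt P (a ^ n) = n * ordAt P a := by
  induction n with
  | zero =>
    classical
    simp only [pow_zero, ordAt, Ideal.span_singleton_one, zero_mul]
    rw [← Ideal.one_eq_top, normalizedFactors_one]
    simp
  | succ n ih => rw [pow_succ, ordAt_mul P (pow_ne_zero n ha) ha, ih]; ring

lemma ordAt_eq_zero {P : Ideal R} (hP : P.IsPrime) (hP0 : P ≠ ⊥) {b : R} (hb : b ∉ P) :
    ordAt P b = 0 := by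
  by_contra h
  have hb0 : b ≠ 0 := by rintro rfl; exact hb P.zero_mem
  have := (mem_pow_iff_le_ordAt hP hP0 hb0 1).2 (Nat.one_le_iff_ne_zero.2 h)
  rw [pow_one] at this
  exact hb this

lemma ordAt_pos {P : Ideal R} (hP : P.IsPrime) (hP0 : P ≠ ⊥) {b : R} (hb0 : b ≠ 0) :
    b ∈ P ↔ 0 < ordAt P b := by
  rw [← Nat.succ_le_iff, ← mem_pow_iff_le_ordAt hP hP0 hb0, pow_one]

lemma exists_common_ordAt {P : Ideal R} (hP : P.IsPrime) (hP0 : P ≠ ⊥) {A B C : R}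
    (h : ¬(A = 0 ∧ B = 0 ∧ C = 0)) :
    ∃ m, (A ∈ P ^ m ∧ B ∈ P ^ m ∧ C ∈ P ^ m) ∧
      ¬(A ∈ P ^ (m + 1) ∧ B ∈ P ^ (m + 1) ∧ C ∈ P ^ (m + 1)) := by
  by_contra! hcon
  have hall : ∀ m, A ∈ P ^ m ∧ B ∈ P ^ m ∧ C ∈ P ^ m := by
    intro m
    induction m with
    | zero => simp
    | succ m ih => exact hcon m ih
  have h0 : ∀ a : R, (∀ m, a ∈ P ^ m) → a = 0 := by
    intro a ha
    by_contra h0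
    have := (mem_pow_iff_le_ordAt hP hP0 h0 _).1 (ha (ordAt P a + 1))
    omega
  exact h ⟨h0 _ fun m => (hall m).1, h0 _ fun m => (hall m).2.1, h0 _ fun m => (hall m).2.2⟩

/-- At a prime whose residue field contains no root of `t³ + t + 1`, the valuation of the norm form
is three times the minimum of the valuations of its arguments. -/
lemma ordAt_cubicNorm {P : Ideal R} (hP : P.IsPrime) (hP0 : P ≠ ⊥)
    (hroot : CubicRootless (R ⧸ P)) {A B C : R} (h : ¬(A = 0 ∧ B = 0 ∧ C = 0)) :
    cubicNorm A B C ≠ 0 ∧ ∃ m, (A ∈ P ^ m ∧ B ∈ P ^ m ∧ C ∈ P ^ m) ∧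
      ordAt P (cubicNorm A B C) = 3 * m := by
  have hmax : P.IsMaximal := hP.isMaximal hP0
  obtain ⟨m, ⟨hA, hB, hC⟩, hm⟩ := exists_common_ordAt hP hP0 h
  obtain ⟨π, hπ, hπ'⟩ := Ideal.exists_mem_pow_notMem_pow_succ P hP0 hP.ne_top m
  have hπ0 : π ≠ 0 := by rintro rfl; exact hπ' (Ideal.zero_mem _)
  obtain ⟨J, hJ⟩ : P ^ m ∣ Ideal.span {π} := by
    rw [Ideal.dvd_iff_le, Ideal.span_singleton_le_iff_mem]; exact hπ
  obtain ⟨s, hsJ, hsP⟩ : ∃ s ∈ J, s ∉ P := by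
    by_contra! hcon
    apply hπ'
    have : π ∈ P ^ m * J := by rw [← hJ]; exact Ideal.mem_span_singleton_self π
    rw [pow_succ]
    exact Ideal.mul_mono_right hcon this
  have hs0 : s ≠ 0 := by rintro rfl; exact hsP P.zero_mem
  have hdiv : ∀ a ∈ P ^ m, ∃ a', s * a = π * a' := by
    intro a ha
    have : s * a ∈ Ideal.span {π} := by
      rw [hJ, mul_comm s a]; exact Ideal.mul_mem_mul ha hsJ
    exact Ideal.mem_span_singleton.1 this
  have hback : ∀ a a', s * a = π * a' → a' ∈ P → a ∈ P ^ (m + 1) := by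
    intro a a' haa ha'
    have : s * a ∈ P ^ (m + 1) := by
      rw [haa, pow_succ]; exact Ideal.mul_mem_mul hπ ha'
    exact (Ideal.IsPrime.mul_mem_pow P this).resolve_left hsP
  obtain ⟨A', hA'⟩ := hdiv A hA
  obtain ⟨B', hB'⟩ := hdiv B hB
  obtain ⟨C', hC'⟩ := hdiv C hC
  have hN' : cubicNorm A' B' C' ∉ P := by
    intro hmem
    let _ := Ideal.Quotient.field P
    have h0 : cubicNorm (Ideal.Quotient.mk P A') (Ideal.Quotient.mk P B')
        (Ideal.Quotient.mk P C') = 0 := by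
      rw [← map_cubicNorm]; exact Ideal.Quotient.eq_zero_iff_mem.2 hmem
    obtain ⟨h1, h2, h3⟩ := CubicRootless.eq_zero_of_cubicNorm_eq_zero hroot h0
    exact hm ⟨hback A A' hA' (Ideal.Quotient.eq_zero_iff_mem.1 h1),
      hback B B' hB' (Ideal.Quotient.eq_zero_iff_mem.1 h2),
      hback C C' hC' (Ideal.Quotient.eq_zero_iff_mem.1 h3)⟩
  have hN'0 : cubicNorm A' B' C' ≠ 0 := fun h0 => hN' (h0 ▸ P.zero_mem)
  have heq : s ^ 3 * cubicNorm A B C = π ^ 3 * cubicNorm A' B' C' := by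
    rw [← cubicNorm_smul, ← cubicNorm_smul, hA', hB', hC']
  have hN0 : cubicNorm A B C ≠ 0 := by
    intro h0
    rw [h0, mul_zero, eq_comm] at heq
    exact (mul_ne_zero (pow_ne_zero 3 hπ0) hN'0) heq
  refine ⟨hN0, m, ⟨hA, hB, hC⟩, ?_⟩
  have h1 := congrArg (ordAt P) heq
  rw [ordAt_mul P (pow_ne_zero 3 hs0) hN0, ordAt_mul P (pow_ne_zero 3 hπ0) hN'0,
    ordAt_pow P hs0, ordAt_pow P hπ0, ordAt_eq_zero hP hP0 hsP, ordAt_eq_zero hP hP0 hN'] at h1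
  have h2 := (mem_pow_iff_le_ordAt hP hP0 hπ0 m).1 hπ
  have h3 := mt (mem_pow_iff_le_ordAt hP hP0 hπ0 (m + 1)).2 hπ'
  omega

end Dedekind

section PrincipalIdeals

open UniqueFactorizationMonoid

variable {R : Type*} [CommRing R]

lemma Submodule.IsPrincipal.exists_span {I : Ideal R} (h : I.IsPrincipal) :
    ∃ a, I = Ideal.span {a} := ⟨h.1.choose, h.1.choose_spec⟩

lemma Ideal.isPrincipal_span_singleton (a : R) : (Ideal.span {a}).IsPrincipal := ⟨⟨a, rfl⟩⟩

lemma Submodule.IsPrincipal.mul_ideal {I J : Ideal R} (hI : I.IsPrincipal) (hJ : J.IsPrincipal) :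
    (I * J).IsPrincipal := by
  obtain ⟨a, rfl⟩ := hI.exists_span
  obtain ⟨b, rfl⟩ := hJ.exists_span
  rw [Ideal.span_singleton_mul_span_singleton]
  exact Ideal.isPrincipal_span_singleton _

lemma Ideal.isPrincipal_one : (1 : Ideal R).IsPrincipal := by
  rw [Ideal.one_eq_top, ← Ideal.span_singleton_one]
  exact Ideal.isPrincipal_span_singleton _

lemma Submodule.IsPrincipal.pow_ideal {I : Ideal R} (hI : I.IsPrincipal) (n : ℕ) :
    (I ^ n).IsPrincipal := by
  induction n with
  | zero => rw [pow_zero]; exact Ideal.isPrincipal_one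
  | succ n ih => rw [pow_succ]; exact ih.mul_ideal hI

lemma Submodule.IsPrincipal.pow_of_three_dvd {I : Ideal R} (hI : (I ^ 3).IsPrincipal) {n : ℕ}
    (hn : 3 ∣ n) : (I ^ n).IsPrincipal := by
  obtain ⟨k, rfl⟩ := hn
  rw [pow_mul]
  exact hI.pow_ideal k

variable [IsDedekindDomain R]

lemma Submodule.IsPrincipal.of_mul_left {I J : Ideal R} (hI0 : I ≠ ⊥) (hI : I.IsPrincipal)
    (h : (I * J).IsPrincipal) : J.IsPrincipal := by
  obtain ⟨a, rfl⟩ := hI.exists_span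
  obtain ⟨b, hb⟩ := h.exists_span
  obtain ⟨c, rfl⟩ : a ∣ b := by
    rw [← Ideal.mem_span_singleton]
    have hmem : b ∈ Ideal.span {a} * J := by
      rw [hb]; exact Ideal.mem_span_singleton_self b
    exact Ideal.mul_le_left hmem
  rw [← Ideal.span_singleton_mul_span_singleton] at hb
  rw [mul_left_cancel₀ hI0 hb]
  exact Ideal.isPrincipal_span_singleton _

lemma Submodule.IsPrincipal.of_pow_modEq_one {P : Ideal R} (hP0 : P ≠ ⊥) (h3 : (P ^ 3).IsPrincipal)
    {n : ℕ} (hn : n % 3 = 1) (h : (P ^ n).IsPrincipal) : P.IsPrincipal := by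
  have hn' : n = 3 * (n / 3) + 1 := by omega
  rw [hn', pow_succ] at h
  exact Submodule.IsPrincipal.of_mul_left (pow_ne_zero _ hP0)
    (h3.pow_of_three_dvd (dvd_mul_right 3 _)) h

/-- In a factorization of a principal ideal, if all but one of the prime powers are principal,
then so is the last one. -/
lemma isPrincipal_pow_ordAt {P : Ideal R} {b : R} (hb : b ≠ 0)
    (h : ∀ Q : Ideal R, Q.IsPrime → Q ≠ ⊥ → Q ≠ P → b ∈ Q → (Q ^ ordAt Q b).IsPrincipal) :
    (P ^ ordAt P b).IsPrincipal := by
  classical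
  set s := normalizedFactors (Ideal.span {b}) with hs
  have hb' : Ideal.span {b} ≠ 0 := by simpa using hb
  have hcount : ∀ Q : Ideal R, s.count Q = ordAt Q b := by
    intro Q
    rw [ordAt, hs]
  have hfac : ∏ Q ∈ insert P s.toFinset, Q ^ ordAt Q b = Ideal.span {b} := by
    rw [← associated_iff_eq.1 (prod_normalizedFactors hb'), ← hs,
      Finset.prod_multiset_count_of_subset s (insert P s.toFinset) (Finset.subset_insert _ _)]
    simp only [hcount]
  rw [← Finset.mul_prod_erase _ _ (Finset.mem_insert_self P _), mul_comm] at hfac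
  refine Submodule.IsPrincipal.of_mul_left ?_ ?_ (hfac ▸ Ideal.isPrincipal_span_singleton b)
  · intro h0
    rw [h0, ← Ideal.zero_eq_bot, zero_mul] at hfac
    exact hb' hfac.symm
  · refine Finset.prod_induction _ (fun I : Ideal R => I.IsPrincipal)
      (fun _ _ h1 h2 => h1.mul_ideal h2) Ideal.isPrincipal_one ?_
    intro Q hQ
    rw [Finset.mem_erase, Finset.mem_insert] at hQ
    have hQs : Q ∈ s := Multiset.mem_toFinset.1 (hQ.2.resolve_left hQ.1)
    have hprime := prime_of_normalized_factor Q hQs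
    refine h Q (Ideal.isPrime_of_prime hprime) hprime.ne_zero hQ.1 ?_
    rw [← Ideal.span_singleton_le_iff_mem, ← Ideal.dvd_iff_le]
    exact dvd_of_mem_normalizedFactors hQs

end PrincipalIdeals

namespace IntQuad31

open QuadraticAlgebra

instance : Module.Free ℤ IntQuad31 := inferInstance
instance : Module.Finite ℤ IntQuad31 := inferInstance

lemma norm_nonneg (z : IntQuad31) : 0 ≤ z.norm := by
  rw [norm_eq]; nlinarith [sq_nonneg (2 * z.re + z.im), sq_nonneg z.im]

lemma absNorm_natCast (n : ℕ) : Ideal.absNorm (Ideal.span {(n : IntQuad31)}) = n ^ 2 := by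
  rw [absNorm_span, norm_eq]
  simp [Int.natAbs_pow]

lemma absNorm_dvd_norm {P : Ideal IntQuad31} {b : IntQuad31} (h : b ∈ P) :
    Ideal.absNorm P ∣ b.norm.natAbs := by
  rw [← absNorm_span]
  exact Ideal.absNorm_dvd_absNorm_of_le ((Ideal.span_singleton_le_iff_mem _).2 h)

lemma eq_span_of_mem {P : Ideal IntQuad31} {b : IntQuad31} (h : b ∈ P)
    (hn : Ideal.absNorm P = b.norm.natAbs) (hb : b ≠ 0) : P = Ideal.span {b} := by
  obtain ⟨J, hJ⟩ : P ∣ Ideal.span {b} :=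
    Ideal.dvd_iff_le.2 ((Ideal.span_singleton_le_iff_mem _).2 h)
  have h1 := congrArg Ideal.absNorm hJ
  rw [absNorm_span, map_mul, hn] at h1
  have h0 : b.norm.natAbs ≠ 0 := by
    rw [← absNorm_span, Ne, Ideal.absNorm_eq_zero_iff]
    simpa using hb
  have h2 : Ideal.absNorm J = 1 := by
    have := Nat.eq_of_mul_eq_mul_left (Nat.pos_of_ne_zero h0) (h1.symm.trans (mul_one _).symm)
    exact this
  rw [hJ, Ideal.absNorm_eq_one_iff.1 h2, Ideal.mul_top]

/-- A nonzero prime of `ℤ[ω]` is inert or has degree one. -/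
lemma prime_cases {P : Ideal IntQuad31} (hP : P.IsPrime) (hP0 : P ≠ ⊥) :
    ∃ p : ℕ, p.Prime ∧ (p : IntQuad31) ∈ P ∧
      (P = Ideal.span {(p : IntQuad31)} ∨
        Ideal.absNorm P = p ∧ ∃ c : ℤ, (⟨-c, 1⟩ : IntQuad31) ∈ P) := by
  have hmem := Ideal.absNorm_mem P
  have hne : Ideal.absNorm P ≠ 0 := by
    rw [Ne, Ideal.absNorm_eq_zero_iff]; exact hP0
  obtain ⟨p, hp, hpP⟩ : ∃ p : ℕ, p.Prime ∧ (p : IntQuad31) ∈ P := by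
    have h2 : ((Ideal.absNorm P).primeFactorsList.map (Nat.cast : ℕ → IntQuad31)).prod ∈ P := by
      rw [← Nat.cast_list_prod, Nat.prod_primeFactorsList hne]
      exact hmem
    rw [← Multiset.prod_coe, hP.multiset_prod_mem_iff_exists_mem] at h2
    obtain ⟨q, hq, hqP⟩ := h2
    obtain ⟨p, hp, rfl⟩ := List.mem_map.1 (Multiset.mem_coe.1 hq)
    exact ⟨p, Nat.prime_of_mem_primeFactorsList hp, hqP⟩
  refine ⟨p, hp, hpP, ?_⟩
  have hp0 : (p : IntQuad31) ≠ 0 := by exact_mod_cast hp.ne_zero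
  have hdvd : Ideal.absNorm P ∣ p ^ 2 := by
    rw [← absNorm_natCast]
    exact Ideal.absNorm_dvd_absNorm_of_le ((Ideal.span_singleton_le_iff_mem _).2 hpP)
  have hne1 : Ideal.absNorm P ≠ 1 := fun h => hP.ne_top (Ideal.absNorm_eq_one_iff.1 h)
  obtain ⟨i, hi, hPi⟩ := (Nat.dvd_prime_pow hp).1 hdvd
  interval_cases i
  · simp at hPi; exact absurd (by simpa using hPi) hne1
  · right
    rw [pow_one] at hPi
    refine ⟨hPi, ?_⟩
    have hcard : Nat.card (IntQuad31 ⧸ P) = p := by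
      rw [← hPi, Ideal.absNorm_apply, Submodule.cardQuot_apply]
    have : Finite (IntQuad31 ⧸ P) := Nat.finite_of_card_ne_zero (hcard ▸ hp.ne_zero)
    let _ := Fintype.ofFinite (IntQuad31 ⧸ P)
    let e := ZMod.ringEquivOfPrime (IntQuad31 ⧸ P) hp (by rw [← Nat.card_eq_fintype_card, hcard])
    obtain ⟨c, hc⟩ := ZMod.intCast_surjective (e.symm (Ideal.Quotient.mk P ⟨0, 1⟩))
    refine ⟨c, ?_⟩
    have : (⟨-c, 1⟩ : IntQuad31) = ⟨0, 1⟩ - (c : IntQuad31) := by ext <;> simp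
    rw [this, ← Ideal.Quotient.eq_zero_iff_mem, map_sub, sub_eq_zero, map_intCast,
      ← map_intCast e, hc, RingEquiv.apply_symm_apply]
  · left
    refine eq_span_of_mem hpP ?_ hp0
    rw [hPi, ← absNorm_span, absNorm_natCast]

lemma mem_cube_of_two_mem {P : Ideal IntQuad31} {u : IntQuad31} (hu : u * u = u - 8)
    (h2 : (2 : IntQuad31) ∈ P) (huP : u ∈ P) : u ∈ P ^ 3 := by
  have h8 : (8 : IntQuad31) ∈ P ^ 3 := by
    have : (8 : IntQuad31) = 2 ^ 3 := by norm_num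
    rw [this]; exact Ideal.pow_mem_pow h2 3
  have : u = 8 * (u + 1) + u ^ 3 := by
    linear_combination (-u - 1) * hu
  rw [this]
  exact add_mem (Ideal.mul_mem_right _ _ h8) (Ideal.pow_mem_pow huP 3)

/-- An element of small norm in `P` has `P`-order one and its other prime factors have small
norm. -/
lemma ordAt_of_norm_eq {P : Ideal IntQuad31} (hP : P.IsPrime) (hP0 : P ≠ ⊥) {p k : ℕ}
    (hp : p.Prime) (hPp : Ideal.absNorm P = p) {b : IntQuad31} (hbP : b ∈ P)
    (hb : b.norm.natAbs = p * k) (hk0 : 0 < k) (hk : k < p) :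
    ordAt P b = 1 ∧ ∀ Q : Ideal IntQuad31, Q.IsPrime → Q ≠ ⊥ → Q ≠ P → b ∈ Q →
      Ideal.absNorm Q ≤ k := by
  have hb0 : b ≠ 0 := by
    rintro rfl
    have := hp.pos
    have h0 : (0 : IntQuad31).norm = 0 := by simp
    rw [h0] at hb
    simp only [Int.natAbs_zero] at hb
    have := Nat.mul_pos hp.pos hk0
    omega
  constructor
  · have h1 := (ordAt_pos hP hP0 hb0).1 hbP
    have h2 : ¬ 2 ≤ ordAt P b := by
      rw [← mem_pow_iff_le_ordAt hP hP0 hb0]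
      intro h
      have := absNorm_dvd_norm h
      rw [map_pow, hPp, hb, pow_two] at this
      have := Nat.le_of_dvd hk0 (Nat.dvd_of_mul_dvd_mul_left hp.pos this)
      omega
    omega
  · intro Q hQ hQ0 hQP hbQ
    have hcop : IsCoprime P Q := by
      have := hP.isMaximal hP0
      have := hQ.isMaximal hQ0
      exact Ideal.isCoprime_of_isMaximal hQP.symm
    have : b ∈ P * Q := by
      rw [Ideal.mul_eq_inf_of_isCoprime hcop]
      exact ⟨hbP, hbQ⟩
    have := absNorm_dvd_norm this
    rw [map_mul, hPp, hb] at this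
    exact Nat.le_of_dvd hk0 (Nat.dvd_of_mul_dvd_mul_left hp.pos this)

/-- The class group of `ℤ[ω]` is killed by `3`. -/
lemma isPrincipal_cube {P : Ideal IntQuad31} (hP : P.IsPrime) (hP0 : P ≠ ⊥) :
    (P ^ 3).IsPrincipal := by
  induction hn : Ideal.absNorm P using Nat.strong_induction_on generalizing P with
  | _ n ih =>
  obtain ⟨p, hp, hpP, rfl | ⟨hPp, c, hc⟩⟩ := prime_cases hP hP0
  · exact (Ideal.isPrincipal_span_singleton _).pow_ideal 3
  obtain rfl : n = p := hn.symm.trans hPp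
  clear hn
  obtain ⟨d, hd, hd1, hd2⟩ : ∃ d : ℤ, (⟨-d, 1⟩ : IntQuad31) ∈ P ∧ -n ≤ 2 * d - 1 ∧
      2 * d - 1 ≤ n := by
    have hn0 := hp.pos
    refine ⟨(c + (n - 1) / 2) % n - (n - 1) / 2, ?_, ?_⟩
    · have h1 := Int.emod_add_mul_ediv (c + (n - 1) / 2) n
      have : (⟨-((c + (n - 1) / 2) % n - (n - 1) / 2), 1⟩ : IntQuad31) =
          ⟨-c, 1⟩ + (n : IntQuad31) * (((c + (n - 1) / 2) / n : ℤ) : IntQuad31) := by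
        ext
        · simp; linarith
        · simp
      rw [this]
      exact add_mem hc (Ideal.mul_mem_right _ _ hpP)
    · have := Int.emod_nonneg (c + (n - 1) / 2) (b := n) (by omega)
      have := Int.emod_lt_of_pos (c + (n - 1) / 2) (b := n) (by omega)
      omega
  have hnorm : (⟨-d, 1⟩ : IntQuad31).norm = d ^ 2 - d + 8 := by
    rw [norm_eq]; ring
  have hdvd := absNorm_dvd_norm hd
  rw [hPp] at hdvd
  obtain ⟨k, hk⟩ := hdvd
  have hpos : 0 < d ^ 2 - d + 8 := by nlinarith [sq_nonneg (2 * d - 1)]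
  have hkZ : d ^ 2 - d + 8 = n * k := by
    rw [← hnorm]
    have := norm_nonneg (⟨-d, 1⟩ : IntQuad31)
    zify at hk
    rwa [abs_of_nonneg this] at hk
  have hk0 : 0 < k := by
    rcases Nat.eq_zero_or_pos k with rfl | h
    · simp at hkZ; omega
    · exact h
  by_cases h4 : n < 4
  · have h2 := hp.two_le
    interval_cases n
    · have hd' : (⟨-d, 1⟩ : IntQuad31).norm = 8 := by
        have : d = 0 ∨ d = 1 := by omega
        rcases this with rfl | rfl <;> rw [hnorm] <;> norm_num
      have h2P : (2 : IntQuad31) ∈ P := by exact_mod_cast hpP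
      obtain ⟨u, hu, huP, hun⟩ : ∃ u : IntQuad31, u * u = u - 8 ∧ u ∈ P ∧ u.norm = 8 := by
        have : d = 0 ∨ d = 1 := by omega
        rcases this with rfl | rfl
        · exact ⟨_, by ext <;> simp, hd, hd'⟩
        · refine ⟨_, ?_, neg_mem hd, ?_⟩
          · ext <;> simp
          · rw [norm_eq]; norm_num
      have hu3 := mem_cube_of_two_mem hu h2P huP
      have hu0 : u ≠ 0 := by rintro rfl; simp at hun
      rw [eq_span_of_mem hu3 (by rw [map_pow, hPp, hun]; rfl) hu0]
      exact Ideal.isPrincipal_span_singleton _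
    · exfalso
      have : d = -1 ∨ d = 0 ∨ d = 1 ∨ d = 2 := by omega
      rcases this with rfl | rfl | rfl | rfl <;> omega
  · have hkn : k < n := by
      zify
      by_contra! hcon
      have h1 : (n : ℤ) * n ≤ n * k := by nlinarith
      have h2 : (4 : ℤ) ≤ n := by omega
      have h3 : (2 * d - 1) ^ 2 ≤ (n : ℤ) ^ 2 := sq_le_sq' hd1 hd2
      nlinarith
    obtain ⟨h1, hQ⟩ := ordAt_of_norm_eq hP hP0 hp hPp hd hk hk0 hkn
    have hb0 : (⟨-d, 1⟩ : IntQuad31) ≠ 0 := by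
      intro h
      have := congrArg QuadraticAlgebra.im h
      simp at this
    have := isPrincipal_pow_ordAt (P := P) (pow_ne_zero 3 hb0) (fun Q hQp hQ0 hQP hbQ => by
      rw [ordAt_pow Q hb0, pow_mul]
      have := (hQ Q hQp hQ0 hQP (hQp.mem_of_pow_mem 3 hbQ)).trans_lt hkn
      exact (ih _ this hQp hQ0 rfl).pow_ideal _)
    rwa [ordAt_pow P hb0, h1] at this

end IntQuad31

section Computation

/-! ### A kernel-friendly test that `t³ + t + 1` has no root modulo `n`

The functions below are written with raw operations on natural numbers and in
continuation-passing style, so that every intermediate value is evaluated exactly once. -/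

/-- Apply `K` to the evaluated numeral `a`. -/
def forceNat (a : ℕ) (K : ℕ → Bool) : Bool :=
  Nat.rec (motive := fun _ => Bool) false (fun k _ => K k) (Nat.add a 1)

lemma forceNat_eq (a : ℕ) (K : ℕ → Bool) : forceNat a K = K a := rfl

/-- Square `x + y t + z t²` modulo `t³ + t + 1` and `n = m + 1`, and multiply by `t` if required. -/
def cubicStep (n m : ℕ) (odd : Bool) (K : ℕ → ℕ → ℕ → Bool) (x y z : ℕ) : Bool :=
  forceNat (Nat.mul z (Nat.add y y)) fun d₃ =>
  forceNat (Nat.mul z z) fun d₄ =>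
  forceNat (Nat.mod (Nat.add (Nat.mul x x) (Nat.mul m d₃)) n) fun a =>
  forceNat (Nat.mod (Nat.add (Nat.mul x (Nat.add y y)) (Nat.mul m (Nat.add d₃ d₄))) n) fun b =>
  forceNat (Nat.mod (Nat.add (Nat.add (Nat.mul x (Nat.add z z)) (Nat.mul y y))
    (Nat.mul m d₄)) n) fun c =>
  Bool.rec (K a b c) (forceNat (Nat.mul m c) fun d => K d (Nat.add a d) b) odd

/-- Pass the coordinates of `t ^ e` modulo `t³ + t + 1` and `n = m + 1` to `K`. -/
def cubicPow (n m : ℕ) (fuel : ℕ) : ℕ → (ℕ → ℕ → ℕ → Bool) → Bool :=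
  Nat.rec (motive := fun _ => ℕ → (ℕ → ℕ → ℕ → Bool) → Bool) (fun _ K => K 1 0 0)
    (fun _ ih e K => forceNat (Nat.div e 2) fun e' =>
      ih e' (cubicStep n m (Nat.beq (Nat.mod e 2) 1) K)) fuel

/-- Whether the norm of `t ^ n - t` modulo `t³ + t + 1` is nonzero modulo `n`. -/
def noRootTest (n : ℕ) : Bool :=
  forceNat (Nat.sub n 1) fun m =>
  cubicPow n m 16 n fun x y' w => forceNat (Nat.mod (Nat.add y' m) n) fun y =>
    Bool.not (Nat.beq 0 (Nat.mod (x ^ 3 + 2 * m * x ^ 2 * w + x * y ^ 2 + 3 * x * y * w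
      + x * w ^ 2 + m * y ^ 3 + m * y * w ^ 2 + w ^ 3) n))

/-- The bits `i = u² + 31 v²` with `u < a`, `v < b`. -/
def formMask (a b : ℕ) : ℕ :=
  Nat.rec (motive := fun _ => ℕ) 0 (fun v s =>
    Nat.rec (motive := fun _ => ℕ) s (fun u s' =>
      Nat.lor s' (Nat.shiftLeft 1 (Nat.add (Nat.mul u u) (Nat.mul 31 (Nat.mul v v))))) a) b

/-- Whether `f k` holds for all `k < n`. -/
def allBelow (f : ℕ → Bool) (n : ℕ) : Bool :=
  Nat.rec (motive := fun _ => Bool) true (fun k ih => Bool.rec false ih (f k)) n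

/-- A sufficient criterion for the primes of `ℤ[ω]` above the prime `n` to be principal or to have
no root of `t³ + t + 1` in their residue fields. -/
def residueCheck (M F n : ℕ) : Bool :=
  (Nat.blt 13 n && !Nat.beq (Nat.gcd n 5005) 1) || (Nat.blt 190 n && !Nat.beq (Nat.gcd n F) 1) ||
  Nat.beq (Nat.mod (Nat.pow n 15) 31) 30 || Nat.beq (Nat.mod (Nat.shiftRight M n) 2) 1 ||
  noRootTest n

lemma allBelow_eq_true {f : ℕ → Bool} {n : ℕ} (h : allBelow f n = true) : ∀ k < n, f k = true := by
  induction n with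
  | zero => intro k hk; omega
  | succ n ih =>
    have h' : (Bool.rec false (allBelow f n) (f n) : Bool) = true := h
    cases hf : f n with
    | false => rw [hf] at h'; simp at h'
    | true =>
      rw [hf] at h'
      intro k hk
      rcases Nat.lt_succ_iff_lt_or_eq.1 hk with hk | rfl
      · exact ih h' k hk
      · exact hf

lemma exists_of_formMask {a b n : ℕ} (h : (formMask a b).testBit n = true) :
    ∃ u v : ℕ, n = u ^ 2 + 31 * v ^ 2 := by
  induction b with
  | zero => simp [formMask] at h
  | succ v ih =>
    have aux : ∀ a', Nat.testBit (Nat.rec (motive := fun _ => ℕ) (formMask a v) (fun u s' =>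
      Nat.lor s' (Nat.shiftLeft 1 (Nat.add (Nat.mul u u) (Nat.mul 31 (Nat.mul v v))))) a') n = true →
        ∃ u v : ℕ, n = u ^ 2 + 31 * v ^ 2 := by
      intro a'
      induction a' with
      | zero => exact ih
      | succ u ihu =>
        intro hu
        have hu' := (Nat.testBit_or _ _ _).symm.trans hu
        rw [Bool.or_eq_true] at hu'
        rcases hu' with hu' | hu'
        · exact ihu hu'
        · have h1 : Nat.testBit (1 <<< (u * u + 31 * (v * v))) n = true := hu'
          rw [Nat.one_shiftLeft, Nat.testBit_two_pow, decide_eq_true_eq] at h1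
          exact ⟨u, v, by rw [← h1]; ring⟩
    exact aux a h

variable {A : Type*} [CommRing A]

lemma natCast_mod_of_eq_zero {n : ℕ} (hn : (n : A) = 0) (a : ℕ) : ((a % n : ℕ) : A) = a := by
  conv_rhs => rw [← Nat.mod_add_div a n]
  simp [hn]

lemma exists_of_cubicPow {n m : ℕ} (hnm : m + 1 = n) (hn : (n : A) = 0) {r : A}
    (hr : r ^ 3 + r + 1 = 0) (fuel : ℕ) : ∀ {e : ℕ} {K : ℕ → ℕ → ℕ → Bool}, e < 2 ^ fuel →
    cubicPow n m fuel e K = true →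
      ∃ x y z : ℕ, K x y z = true ∧ (x + y * r + z * r ^ 2 : A) = r ^ e := by
  have hm : (m : A) = -1 := by
    rw [← hnm] at hn; push_cast at hn; linear_combination hn
  induction fuel with
  | zero =>
    intro e K he h
    obtain rfl : e = 0 := by simpa using he
    exact ⟨1, 0, 0, h, by simp⟩
  | succ fuel ih =>
    intro e K he h
    have h1 : cubicPow n m fuel (e / 2) (cubicStep n m (Nat.beq (e % 2) 1) K) = true := h
    obtain ⟨x, y, z, hK, hxyz⟩ := ih (by rw [pow_succ] at he; omega) h1
    set a := (x * x + m * (z * (y + y))) % n with ha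
    set b := (x * (y + y) + m * (z * (y + y) + z * z)) % n with hb
    set c := (x * (z + z) + y * y + m * (z * z)) % n with hc
    have hK' : (Bool.rec (K a b c) (K (m * c) (a + m * c) b) (Nat.beq (e % 2) 1) : Bool) = true := hK
    have ha' : (a : A) = x * x - z * (y + y) := by
      rw [ha, natCast_mod_of_eq_zero hn]; push_cast; rw [hm]; ring
    have hb' : (b : A) = x * (y + y) - (z * (y + y) + z * z) := by
      rw [hb, natCast_mod_of_eq_zero hn]; push_cast; rw [hm]; ring
    have hc' : (c : A) = x * (z + z) + y * y - z * z := by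
      rw [hc, natCast_mod_of_eq_zero hn]; push_cast; rw [hm]; ring
    have hsq : (a + b * r + c * r ^ 2 : A) = r ^ (e / 2) * r ^ (e / 2) := by
      rw [ha', hb', hc', ← hxyz]
      linear_combination (-(z : A) ^ 2 * r - 2 * y * z) * hr
    rcases Nat.mod_two_eq_zero_or_one e with h2 | h2
    · rw [h2] at hK'
      refine ⟨a, b, c, hK', ?_⟩
      rw [hsq, ← pow_add]
      congr 1
      omega
    · rw [h2] at hK'
      refine ⟨m * c, a + m * c, b, hK', ?_⟩
      have he' : e = e / 2 + e / 2 + 1 := by omega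
      conv_rhs => rw [he', pow_succ, pow_add, ← hsq]
      push_cast
      rw [hm]
      linear_combination (-(c : A)) * hr

lemma cubicNorm_eq_zero_of_root {r : A} (hr : r ^ 3 + r + 1 = 0) {a b c : A}
    (h : a + b * r + c * r ^ 2 = 0) : cubicNorm a b c = 0 := by
  have key : cubicNorm a b c = (a + b * r + c * r ^ 2) * (((a - c) ^ 2 + b * (b + c))
      - (b * (a - c) + c * (b + c)) * r + (b ^ 2 - c * (a - c)) * r ^ 2)
      - (b * (b ^ 2 - c * (a - c)) - c * (b * (a - c) + c * (b + c))
        + c * (b ^ 2 - c * (a - c)) * r) * (r ^ 3 + r + 1) := by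
    unfold cubicNorm; ring
  rw [key, h, hr]; ring

lemma false_of_natCast_eq_zero [Nontrivial A] {n k : ℕ} (hp : n.Prime) (hn : (n : A) = 0)
    (hk : (k : A) = 0) (hnk : ¬ n ∣ k) : False := by
  have h : IsCoprime (n : A) (k : A) := ((hp.coprime_iff_not_dvd).2 hnk).cast
  rw [hn, hk] at h
  exact not_isCoprime_zero_zero h

lemma cubicRootless_of_noRootTest [Nontrivial A] {n : ℕ} (hp : n.Prime) (hn : (n : A) = 0)
    (hn16 : n < 2 ^ 16) (hfrob : ∀ a : A, a ^ n = a) (h : noRootTest n = true) :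
    CubicRootless A := by
  intro r hr
  have hm : n - 1 + 1 = n := Nat.sub_add_cancel hp.one_le
  rw [noRootTest, forceNat_eq] at h
  obtain ⟨x, y, w, hK, hxyw⟩ := exists_of_cubicPow hm hn hr 16 hn16 h
  have hmc : ((n - 1 : ℕ) : A) = -1 := by
    have := hn
    rw [← hm] at this; push_cast at this; linear_combination this
  have hK' : Bool.not (Nat.beq 0 ((fun y => x ^ 3 + 2 * (n - 1) * x ^ 2 * w + x * y ^ 2
      + 3 * x * y * w + x * w ^ 2 + (n - 1) * y ^ 3 + (n - 1) * y * w ^ 2 + w ^ 3)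
      ((y + (n - 1)) % n) % n)) = true := hK
  have hzero : cubicNorm (x : A) (y - 1) w = 0 := by
    apply cubicNorm_eq_zero_of_root hr
    rw [hfrob] at hxyw
    linear_combination hxyw
  refine false_of_natCast_eq_zero (A := A) hp hn (k := (fun y => x ^ 3 + 2 * (n - 1) * x ^ 2 * w
      + x * y ^ 2 + 3 * x * y * w + x * w ^ 2 + (n - 1) * y ^ 3 + (n - 1) * y * w ^ 2 + w ^ 3)
      ((y + (n - 1)) % n)) ?_ ?_
  · have hy : (((y + (n - 1)) % n : ℕ) : A) = y - 1 := by
      rw [natCast_mod_of_eq_zero hn]; push_cast; rw [hmc]; ring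
    rw [← hzero]
    simp only
    push_cast
    rw [hy, hmc]
    unfold cubicNorm
    ring
  · intro hdvd
    rw [Nat.mod_eq_zero_of_dvd hdvd] at hK'
    exact absurd hK' (by decide)

/-- The check for all `n ≡ ±1` modulo `6` below `36000`. -/
def residueCheckAll : Bool :=
  forceNat (formMask 190 35) fun M => forceNat (Nat.factorial 190) fun F =>
    allBelow (fun i => allBelow (fun j => forceNat (Nat.add (Nat.mul 480 i) (Nat.mul 6 j)) fun k =>
      residueCheck M F (Nat.add k 1) && residueCheck M F (Nat.add k 5)) 80) 75

set_option maxRecDepth 100000 in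
lemma residueCheckAll_eq_true : residueCheckAll = true := by
  decide +kernel

end Computation

namespace IntQuad31

open QuadraticAlgebra

lemma card_quotient (P : Ideal IntQuad31) : Nat.card (IntQuad31 ⧸ P) = Ideal.absNorm P := by
  rw [Ideal.absNorm_apply, Submodule.cardQuot_apply]

lemma natCast_quotient_eq_zero {P : Ideal IntQuad31} {n : ℕ} (h : (n : IntQuad31) ∈ P) :
    (n : IntQuad31 ⧸ P) = 0 := by
  rw [← map_natCast (Ideal.Quotient.mk P)]
  exact Ideal.Quotient.eq_zero_iff_mem.2 h

lemma cubicRootless_quotient {P : Ideal IntQuad31} (hP : P.IsPrime) (hP0 : P ≠ ⊥) {n : ℕ}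
    (hn : n.Prime) (hnP : (n : IntQuad31) ∈ P) (hPn : Ideal.absNorm P = n) (hn16 : n < 2 ^ 16)
    (h : noRootTest n = true) : CubicRootless (IntQuad31 ⧸ P) := by
  have := hP.isMaximal hP0
  let _ := Ideal.Quotient.field P
  have : Finite (IntQuad31 ⧸ P) :=
    Nat.finite_of_card_ne_zero (by rw [card_quotient, hPn]; exact hn.ne_zero)
  let _ := Fintype.ofFinite (IntQuad31 ⧸ P)
  refine cubicRootless_of_noRootTest hn (natCast_quotient_eq_zero hnP) hn16 (fun a => ?_) h
  have h1 := FiniteField.pow_card a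
  rwa [← Nat.card_eq_fintype_card, card_quotient, hPn] at h1

lemma residueCheck_of_prime {n : ℕ} (hn : n.Prime) (hn5 : 5 ≤ n) (hlt : n < 36000) :
    residueCheck (formMask 190 35) (Nat.factorial 190) n = true := by
  have h := residueCheckAll_eq_true
  rw [residueCheckAll, forceNat_eq, forceNat_eq] at h
  have h1 := allBelow_eq_true (allBelow_eq_true h (n / 480) (by omega)) ((n % 480) / 6) (by omega)
  rw [forceNat_eq, Bool.and_eq_true] at h1
  have h6 : n % 6 = 1 ∨ n % 6 = 5 := by
    have h2 : n % 2 = 1 := (hn.eq_two_or_odd).resolve_left (by omega)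
    have h3 : ¬ n % 3 = 0 := fun h0 => by
      have := (Nat.prime_dvd_prime_iff_eq Nat.prime_three hn).1 (Nat.dvd_of_mod_eq_zero h0)
      omega
    omega
  have h0 : Nat.add (Nat.mul 480 (n / 480)) (Nat.mul 6 (n % 480 / 6))
      = 480 * (n / 480) + 6 * (n % 480 / 6) := rfl
  rw [h0] at h1
  rcases h6 with h6 | h6
  · have h2 : 480 * (n / 480) + 6 * (n % 480 / 6) + 1 = n := by omega
    rw [← h2]; exact h1.1
  · have h2 : 480 * (n / 480) + 6 * (n % 480 / 6) + 5 = n := by omega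
    rw [← h2]; exact h1.2

lemma residueCheck_cases {n : ℕ} (hn : n.Prime) {M : ℕ}
    (hM : M.testBit n = true → ∃ u v : ℕ, n = u ^ 2 + 31 * v ^ 2)
    (h : residueCheck M (Nat.factorial 190) n = true) :
    n ^ 15 % 31 = 30 ∨ (∃ u v : ℕ, n = u ^ 2 + 31 * v ^ 2) ∨ noRootTest n = true := by
  rw [residueCheck] at h
  simp only [Bool.or_eq_true, Bool.and_eq_true, Bool.not_eq_true', Nat.blt_eq] at h
  rcases h with ((((⟨h1, h2⟩ | ⟨h1, h2⟩) | h1) | h1) | h1)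
  · exfalso
    have h3 : n ∣ 5 * (7 * (11 * 13)) :=
      (Nat.coprime_or_dvd_of_prime hn _).resolve_left (Nat.ne_of_beq_eq_false h2)
    rcases hn.dvd_mul.1 h3 with h | h
    · have := Nat.le_of_dvd (by norm_num) h; omega
    rcases hn.dvd_mul.1 h with h | h
    · have := Nat.le_of_dvd (by norm_num) h; omega
    rcases hn.dvd_mul.1 h with h | h
    · have := Nat.le_of_dvd (by norm_num) h; omega
    · have := Nat.le_of_dvd (by norm_num) h; omega
  · exfalso
    have h3 : n ∣ Nat.factorial 190 := (Nat.coprime_or_dvd_of_prime hn _).resolve_left (Nat.ne_of_beq_eq_false h2)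
    have := (hn.dvd_factorial).1 h3
    omega
  · exact Or.inl (Nat.eq_of_beq_eq_true h1)
  · refine Or.inr (Or.inl (hM ?_))
    rw [Nat.testBit_eq_decide_div_mod_eq, decide_eq_true_eq, ← Nat.shiftRight_eq_div_pow]
    exact Nat.eq_of_beq_eq_true h1
  · exact Or.inr (Or.inr h1)

/-- The norm of a prime ideal of degree one is not congruent to a nonresidue modulo `31`. -/
lemma absNorm_pow_mod {P : Ideal IntQuad31} (hP : P.IsPrime) (hP0 : P ≠ ⊥) :
    Ideal.absNorm P ^ 15 % 31 ≠ 30 := by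
  obtain ⟨g, hg⟩ := (isPrincipal_cube hP hP0).exists_span
  have h1 := congrArg Ideal.absNorm hg
  rw [map_pow, absNorm_span] at h1
  have h2 : ((Ideal.absNorm P ^ 3 : ℕ) : ℤ) = g.re ^ 2 + g.re * g.im + 8 * g.im ^ 2 := by
    rw [h1, ← norm_eq, Int.natAbs_of_nonneg (norm_nonneg g)]
  have h3 : (2 * g.re + g.im : ZMod 31) ^ 2 = 4 * (Ideal.absNorm P : ZMod 31) ^ 3 := by
    have h4 := congrArg (Int.cast : ℤ → ZMod 31) h2
    push_cast at h4
    have h31 : (31 : ZMod 31) = 0 := by decide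
    rw [h4]
    linear_combination (-(g.im : ZMod 31) ^ 2) * h31
  have key : ∀ p x : ZMod 31, x ^ 2 = 4 * p ^ 3 → p ^ 15 ≠ 30 := by decide +kernel
  intro h
  refine key _ _ h3 ?_
  have := congrArg (Nat.cast : ℕ → ZMod 31) h
  rw [ZMod.natCast_mod] at this
  exact_mod_cast this

lemma isPrincipal_of_root_of_lt {P : Ideal IntQuad31} (hP : P.IsPrime) (hP0 : P ≠ ⊥)
    (hroot : ¬ CubicRootless (IntQuad31 ⧸ P)) (hlt : Ideal.absNorm P < 36000) :
    P.IsPrincipal := by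
  obtain ⟨n, hn, hnP, rfl | ⟨hPn, c, hc⟩⟩ := prime_cases hP hP0
  · exact Ideal.isPrincipal_span_singleton _
  rw [hPn] at hlt
  have hno : noRootTest n ≠ true := fun h =>
    hroot (cubicRootless_quotient hP hP0 hn hnP hPn (by omega) h)
  have h3 : n ≠ 3 := by
    rintro rfl
    have h1 := absNorm_dvd_norm hc
    rw [hPn, norm_eq] at h1
    have h2 : (3 : ℤ) ∣ c ^ 2 - c + 8 := by
      have := Int.natCast_dvd.2 h1
      convert this using 1
      simp; ring
    obtain ⟨d, hd⟩ : ∃ d, c = 3 * d ∨ c = 3 * d + 1 ∨ c = 3 * d + 2 := ⟨c / 3, by omega⟩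
    rcases hd with rfl | rfl | rfl <;> ring_nf at h2 <;> omega
  have h2 : n ≠ 2 := by
    rintro rfl
    exact hno (by decide +kernel)
  have h4 : n ≠ 4 := by rintro rfl; exact absurd hn (by norm_num)
  have hge := hn.two_le
  rcases residueCheck_cases hn exists_of_formMask
    (residueCheck_of_prime hn (by omega) hlt) with h | ⟨u, v, h⟩ | h
  · exact absurd h (hPn ▸ absNorm_pow_mod hP hP0)
  · have hmul : (⟨u - v, 2 * v⟩ : IntQuad31) * ⟨u + v, -2 * v⟩ ∈ P := by
      have h1 : (⟨u - v, 2 * v⟩ : IntQuad31) * ⟨u + v, -2 * v⟩ = (n : IntQuad31) := by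
        have hZ : (n : ℤ) = u ^ 2 + 31 * v ^ 2 := by exact_mod_cast h
        ext
        · simp [hZ]; ring
        · simp; ring
      rw [h1]; exact hnP
    have hgen : ∀ g ∈ P, g.norm = u ^ 2 + 31 * v ^ 2 → P.IsPrincipal := by
      intro g hg hgn
      have h5 : g.norm = (n : ℤ) := by rw [hgn, h]; push_cast; ring
      have hg0 : g ≠ 0 := by
        rintro rfl
        simp at h5
        omega
      rw [eq_span_of_mem hg (by rw [hPn, h5]; rfl) hg0]
      exact Ideal.isPrincipal_span_singleton _
    rcases hP.mem_or_mem hmul with hm | hm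
    · exact hgen _ hm (by rw [norm_eq]; ring)
    · exact hgen _ hm (by rw [norm_eq]; ring)
  · exact absurd h hno

end IntQuad31

lemma norm_cubicNorm_le {x z w : ℂ} {s : ℝ} (hx : ‖x‖ ≤ s) (hz : ‖z‖ ≤ s) (hw : ‖w‖ ≤ s) :
    ‖cubicNorm x z w‖ ≤ 11 * s ^ 3 := by
  have hs : 0 ≤ s := (norm_nonneg x).trans hx
  have hmul : ∀ a b c : ℂ, ‖a‖ ≤ s → ‖b‖ ≤ s → ‖c‖ ≤ s → ‖a * b * c‖ ≤ s ^ 3 := by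
    intro a b c ha hb hc
    rw [norm_mul, norm_mul, pow_succ, pow_two]
    gcongr
  have h : cubicNorm x z w = x * x * x + -(x * x * w) + -(x * x * w) + x * z * z + x * z * w
      + x * z * w + x * z * w + x * w * w + -(z * z * z) + -(z * w * w) + w * w * w := by
    unfold cubicNorm; ring
  rw [h]
  have h1 := hmul x x x hx hx hx
  have h2 := hmul x x w hx hx hw
  have h3 := hmul x z z hx hz hz
  have h4 := hmul x z w hx hz hw
  have h5 := hmul x w w hx hw hw
  have h6 := hmul z z z hz hz hz
  have h7 := hmul z w w hz hw hw
  have h8 := hmul w w w hw hw hw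
  rw [← norm_neg] at h2 h6 h7
  have key : ∀ {a b : ℂ} {u v : ℝ}, ‖a‖ ≤ u → ‖b‖ ≤ v → ‖a + b‖ ≤ u + v := fun ha hb =>
    (norm_add_le _ _).trans (add_le_add ha hb)
  refine (key (key (key (key (key (key (key (key (key (key h1 h2) h2) h3) h4) h4) h4) h5) h6) h7)
    h8).trans (le_of_eq ?_)
  ring

namespace IntQuad31

open QuadraticAlgebra

/-- A complex embedding of `ℤ[ω]`. -/
noncomputable def toComplex : IntQuad31 →+* ℂ :=
  homOfRoot ⟨1 / 2, √31 / 2⟩ (by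
    have h : √31 * √31 = (31 : ℝ) := Real.mul_self_sqrt (by norm_num)
    apply Complex.ext
    · simp; linarith
    · simp; ring)

lemma norm_toComplex_sq (z : IntQuad31) : ‖toComplex z‖ ^ 2 = (z.norm : ℝ) := by
  have h : √31 * √31 = (31 : ℝ) := Real.mul_self_sqrt (by norm_num)
  rw [← Complex.normSq_eq_norm_sq, toComplex, homOfRoot_apply, Complex.normSq_apply, norm_eq]
  simp
  linear_combination ((z.im : ℝ) ^ 2 / 4) * h

lemma norm_cubicNorm_le {A B C : IntQuad31} {s : ℝ} (hs : 0 ≤ s) (hA : (A.norm : ℝ) ≤ s ^ 2)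
    (hB : (B.norm : ℝ) ≤ s ^ 2) (hC : (C.norm : ℝ) ≤ s ^ 2) :
    ((cubicNorm A B C).norm : ℝ) ≤ 121 * s ^ 6 := by
  have hle : ∀ z : IntQuad31, (z.norm : ℝ) ≤ s ^ 2 → ‖toComplex z‖ ≤ s := by
    intro z hz
    rw [← norm_toComplex_sq] at hz
    exact (pow_le_pow_iff_left₀ (_root_.norm_nonneg _) hs two_ne_zero).1 hz
  have h := _root_.norm_cubicNorm_le (hle A hA) (hle B hB) (hle C hC)
  rw [← map_cubicNorm] at h
  rw [← norm_toComplex_sq]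
  calc _ ≤ (11 * s ^ 3) ^ 2 := pow_le_pow_left₀ (_root_.norm_nonneg _) h 2
    _ = _ := by ring

lemma norm_le_of_box {z : IntQuad31} {U V : ℝ} (hU : |(z.re : ℝ)| ≤ U) (hV : |(z.im : ℝ)| ≤ V) :
    (z.norm : ℝ) ≤ U ^ 2 + U * V + 8 * V ^ 2 := by
  rw [norm_eq]
  push_cast
  have h1 : (z.re : ℝ) * z.im ≤ U * V := by
    refine (le_abs_self _).trans ?_
    rw [abs_mul]
    exact mul_le_mul hU hV (abs_nonneg _) ((abs_nonneg _).trans hU)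
  have h2 : (z.re : ℝ) ^ 2 ≤ U ^ 2 := by
    rw [← sq_abs]; exact pow_le_pow_left₀ (abs_nonneg _) hU 2
  have h3 : (z.im : ℝ) ^ 2 ≤ V ^ 2 := by
    rw [← sq_abs]; exact pow_le_pow_left₀ (abs_nonneg _) hV 2
  linarith

/-- A Thue-type lemma: modulo a prime of degree one, there is a small nontrivial relation
`A + B r + C r² = 0`. -/
lemma exists_small_relation (P : Ideal IntQuad31) {U V : ℕ}
    (hP0 : Ideal.absNorm P ≠ 0)
    (hlt : Ideal.absNorm P < ((U + 1) * (V + 1)) ^ 3) (r : IntQuad31 ⧸ P) :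
    ∃ A B C : IntQuad31, ¬(A = 0 ∧ B = 0 ∧ C = 0) ∧
      Ideal.Quotient.mk P A + Ideal.Quotient.mk P B * r + Ideal.Quotient.mk P C * r ^ 2 = 0 ∧
      ∀ z, z = A ∨ z = B ∨ z = C → |(z.re : ℝ)| ≤ U ∧ |(z.im : ℝ)| ≤ V := by
  have : Finite (IntQuad31 ⧸ P) := Nat.finite_of_card_ne_zero (by rwa [card_quotient])
  let _ := Fintype.ofFinite (IntQuad31 ⧸ P)
  let box := Fin (U + 1) × Fin (V + 1)
  let g : box → IntQuad31 := fun a => ⟨(a.1 : ℕ), (a.2 : ℕ)⟩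
  have hg : ∀ a b : box, |((g a - g b).re : ℝ)| ≤ U ∧ |((g a - g b).im : ℝ)| ≤ V := by
    intro a b
    have ha1 : ((a.1 : ℕ) : ℝ) ≤ U := by exact_mod_cast Nat.lt_succ_iff.1 a.1.2
    have ha2 : ((a.2 : ℕ) : ℝ) ≤ V := by exact_mod_cast Nat.lt_succ_iff.1 a.2.2
    have hb1 : ((b.1 : ℕ) : ℝ) ≤ U := by exact_mod_cast Nat.lt_succ_iff.1 b.1.2
    have hb2 : ((b.2 : ℕ) : ℝ) ≤ V := by exact_mod_cast Nat.lt_succ_iff.1 b.2.2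
    have e1 : ((a.1 : ℕ) : ℝ) ≥ 0 := Nat.cast_nonneg _
    have e2 : ((a.2 : ℕ) : ℝ) ≥ 0 := Nat.cast_nonneg _
    have e3 : ((b.1 : ℕ) : ℝ) ≥ 0 := Nat.cast_nonneg _
    have e4 : ((b.2 : ℕ) : ℝ) ≥ 0 := Nat.cast_nonneg _
    simp only [g, re_sub, im_sub, Int.cast_sub, Int.cast_natCast, abs_le]
    refine ⟨⟨?_, ?_⟩, ?_, ?_⟩ <;> linarith
  have hg0 : ∀ a b : box, g a - g b = 0 → a = b := by
    intro a b h
    have h1 := congrArg QuadraticAlgebra.re (sub_eq_zero.1 h)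
    have h2 := congrArg QuadraticAlgebra.im (sub_eq_zero.1 h)
    simp only [g, Nat.cast_inj] at h1 h2
    exact Prod.ext (Fin.ext h1) (Fin.ext h2)
  let f : box × box × box → IntQuad31 ⧸ P := fun a =>
    Ideal.Quotient.mk P (g a.1) + Ideal.Quotient.mk P (g a.2.1) * r
      + Ideal.Quotient.mk P (g a.2.2) * r ^ 2
  obtain ⟨a, b, hab, hfab⟩ := Fintype.exists_ne_map_eq_of_card_lt f (by
    rw [← Nat.card_eq_fintype_card, card_quotient]
    simp only [box, Fintype.card_prod, Fintype.card_fin]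
    calc _ < _ := hlt
      _ = _ := by ring)
  refine ⟨g a.1 - g b.1, g a.2.1 - g b.2.1, g a.2.2 - g b.2.2, ?_, ?_, ?_⟩
  · rintro ⟨h1, h2, h3⟩
    exact hab (Prod.ext (hg0 _ _ h1) (Prod.ext (hg0 _ _ h2) (hg0 _ _ h3)))
  · simp only [f] at hfab
    simp only [map_sub]
    linear_combination hfab
  · rintro z (rfl | rfl | rfl) <;> exact hg _ _

lemma exists_small_cubicNorm {P : Ideal IntQuad31} (hP0 : Ideal.absNorm P ≠ 0)
    (hroot : ¬ CubicRootless (IntQuad31 ⧸ P)) :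
    ∃ A B C : IntQuad31, ¬(A = 0 ∧ B = 0 ∧ C = 0) ∧ cubicNorm A B C ∈ P ∧
      (cubicNorm A B C).norm < 36000 * Ideal.absNorm P := by
  simp only [CubicRootless, not_forall, not_not] at hroot
  obtain ⟨r, hr⟩ := hroot
  set p := Ideal.absNorm P with hp
  obtain ⟨t, ht0, ht⟩ : ∃ t : ℝ, 0 ≤ t ∧ t ^ 6 = p / 27 := by
    refine ⟨((p : ℝ) / 27) ^ ((1 : ℝ) / 6), by positivity, ?_⟩
    rw [← Real.rpow_natCast, ← Real.rpow_mul (by positivity)]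
    norm_num
  have hU := Nat.floor_le (show 0 ≤ 3 * t by positivity)
  have hU' := Nat.lt_floor_add_one (3 * t)
  have hV := Nat.floor_le ht0
  have hV' := Nat.lt_floor_add_one t
  set U := ⌊3 * t⌋₊
  set V := ⌊t⌋₊
  obtain ⟨A, B, C, hne, hrel, hbox⟩ := exists_small_relation P (U := U) (V := V) hP0 (by
    have h1 : (p : ℝ) < (((U + 1) * (V + 1)) ^ 3 : ℝ) := by
      have h2 : 3 * t * t < ((U : ℝ) + 1) * (V + 1) := by
        apply mul_lt_mul'' hU' hV' (by positivity) ht0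
      calc (p : ℝ) = (3 * t * t) ^ 3 := by linear_combination (-27 : ℝ) * ht
        _ < _ := pow_lt_pow_left₀ h2 (by positivity) (by norm_num)
    exact_mod_cast h1) r
  refine ⟨A, B, C, hne, ?_, ?_⟩
  · rw [← Ideal.Quotient.eq_zero_iff_mem, map_cubicNorm]
    exact cubicNorm_eq_zero_of_root hr hrel
  · have h20 : (√20 : ℝ) ^ 2 = 20 := Real.sq_sqrt (by norm_num)
    have hle : ∀ z, z = A ∨ z = B ∨ z = C → (z.norm : ℝ) ≤ (√20 * t) ^ 2 := by
      intro z hz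
      refine (norm_le_of_box ((hbox z hz).1.trans hU) ((hbox z hz).2.trans hV)).trans (le_of_eq ?_)
      rw [mul_pow (√20) t, h20]; ring
    have h := norm_cubicNorm_le (s := √20 * t) (by positivity) (hle A (by simp)) (hle B (by simp))
      (hle C (by simp))
    have h6 : 121 * (√20 * t) ^ 6 = 968000 / 27 * p := by
      have : (√20 * t) ^ 6 = ((√20) ^ 2) ^ 3 * t ^ 6 := by ring
      rw [this, h20, ht]; ring
    have hp1 : (0 : ℝ) < p := by exact_mod_cast Nat.pos_of_ne_zero hP0
    have : ((cubicNorm A B C).norm : ℝ) < 36000 * p := by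
      rw [h6] at h
      linarith
    exact_mod_cast this

lemma CubicRootless.of_ringHom {R S : Type*} [CommRing R] [CommRing S] (f : R →+* S)
    (h : CubicRootless S) : CubicRootless R := fun t ht => h (f t) (by
  rw [← map_pow, ← map_add, ← map_one f, ← map_add, ht, map_zero])

lemma ker_homOfRoot_isPrime (p : ℕ) [Fact p.Prime] (u : ZMod p) (hu : u * u = -8 + u) :
    (RingHom.ker (homOfRoot u hu)).IsPrime := RingHom.ker_isPrime _

lemma natCast_mem_ker_homOfRoot (p : ℕ) (u : ZMod p) (hu : u * u = -8 + u) :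
    (p : IntQuad31) ∈ RingHom.ker (homOfRoot u hu) := by
  rw [RingHom.mem_ker, map_natCast, ZMod.natCast_self]

lemma ker_homOfRoot_ne_bot (p : ℕ) [hp : Fact p.Prime] (u : ZMod p) (hu : u * u = -8 + u) :
    RingHom.ker (homOfRoot u hu) ≠ ⊥ := by
  intro h
  have := natCast_mem_ker_homOfRoot p u hu
  rw [h, Ideal.mem_bot] at this
  exact hp.out.ne_zero (by exact_mod_cast this)

lemma cubicRootless_quotient_ker {p : ℕ} {u : ZMod p} (hu : u * u = -8 + u)
    (h : CubicRootless (ZMod p)) :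
    CubicRootless (IntQuad31 ⧸ RingHom.ker (homOfRoot u hu)) :=
  CubicRootless.of_ringHom (RingHom.kerLift (homOfRoot u hu)) h

lemma cubicNorm_ne_zero {A B C : IntQuad31} (h : ¬(A = 0 ∧ B = 0 ∧ C = 0)) :
    cubicNorm A B C ≠ 0 := by
  have hu : (0 : ZMod 2) * 0 = -8 + 0 := by decide
  have h2 : CubicRootless (ZMod 2) := by unfold CubicRootless; decide
  have : Fact (Nat.Prime 2) := ⟨Nat.prime_two⟩
  exact (ordAt_cubicNorm (ker_homOfRoot_isPrime 2 0 hu) (ker_homOfRoot_ne_bot 2 0 hu)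
    (cubicRootless_quotient_ker hu h2) h).1

/-- A prime of `ℤ[ω]` modulo which `t³ + t + 1` has a root is principal. -/
theorem isPrincipal_of_root {P : Ideal IntQuad31} (hP : P.IsPrime) (hP0 : P ≠ ⊥)
    (hroot : ¬ CubicRootless (IntQuad31 ⧸ P)) : P.IsPrincipal := by
  by_cases hlt : Ideal.absNorm P < 36000
  · exact isPrincipal_of_root_of_lt hP hP0 hroot hlt
  obtain ⟨p, hp, hpP, rfl | ⟨hPp, -⟩⟩ := prime_cases hP hP0
  · exact Ideal.isPrincipal_span_singleton _
  obtain ⟨A, B, C, hne, hmem, hlt'⟩ := exists_small_cubicNorm (P := P)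
    (by rw [hPp]; exact hp.ne_zero) hroot
  have hb0 := cubicNorm_ne_zero hne
  obtain ⟨k, hk⟩ := absNorm_dvd_norm hmem
  have hk0 : 0 < k := by
    rcases Nat.eq_zero_or_pos k with rfl | h
    · rw [mul_zero, ← absNorm_span, Ideal.absNorm_eq_zero_iff] at hk
      simp [hb0] at hk
    · exact h
  rw [hPp] at hk hlt' hlt
  have hk' : k < 36000 := by
    have h1 : (p : ℤ) * k < 36000 * p := by
      have : (((cubicNorm A B C).norm.natAbs : ℕ) : ℤ) = p * k := by exact_mod_cast hk
      rw [Int.natAbs_of_nonneg (norm_nonneg _)] at this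
      rwa [← this]
    have h2 : (0 : ℤ) < p := by exact_mod_cast hp.pos
    zify
    nlinarith
  obtain ⟨h1, hQ⟩ := ordAt_of_norm_eq hP hP0 hp hPp hmem hk hk0 (by omega)
  have h2 := isPrincipal_pow_ordAt (P := P) hb0 (fun Q hQp hQ0 hQP hbQ => by
    by_cases hQroot : CubicRootless (IntQuad31 ⧸ Q)
    · obtain ⟨-, m, -, hm⟩ := ordAt_cubicNorm hQp hQ0 hQroot hne
      exact (isPrincipal_cube hQp hQ0).pow_of_three_dvd ⟨m, hm⟩
    · exact (isPrincipal_of_root_of_lt hQp hQ0 hQroot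
        ((hQ Q hQp hQ0 hQP hbQ).trans_lt hk')).pow_ideal _)
  rwa [h1, pow_one] at h2

end IntQuad31

namespace IntQuad31

open QuadraticAlgebra

/-- A root of `T² - 4 T + 35`. -/
def theta : IntQuad31 := ⟨1, 2⟩

/-- The conjugate of `theta`. -/
def thetaConj : IntQuad31 := ⟨3, -2⟩

lemma theta_mul_thetaConj : theta * thetaConj = 35 := by
  ext <;> simp [theta, thetaConj]

lemma theta_add_thetaConj : theta + thetaConj = 4 := by
  ext <;> simp [theta, thetaConj]

lemma intCast_add_intCast_mul_eq_zero {x y : ℤ} {t : IntQuad31} (ht : t.im ≠ 0)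
    (h : (x : IntQuad31) + t * y = 0) : y = 0 := by
  have h1 := congrArg QuadraticAlgebra.im h
  simp at h1
  exact h1.resolve_left ht

/-- The prime above `7` containing `theta`. -/
def primeSeven : Ideal IntQuad31 := RingHom.ker (homOfRoot (3 : ZMod 7) (by decide))

/-- A prime above `5`. -/
def primeFive : Ideal IntQuad31 := RingHom.ker (homOfRoot (2 : ZMod 5) (by decide))

lemma mem_primeSeven (z : IntQuad31) : z ∈ primeSeven ↔ (7 : ℤ) ∣ z.re + 3 * z.im := by
  have h := ZMod.intCast_zmod_eq_zero_iff_dvd (z.re + 3 * z.im) 7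
  push_cast at h
  rw [primeSeven, RingHom.mem_ker, homOfRoot_apply, ← h, mul_comm]

lemma mem_primeFive (z : IntQuad31) : z ∈ primeFive ↔ (5 : ℤ) ∣ z.re + 2 * z.im := by
  have h := ZMod.intCast_zmod_eq_zero_iff_dvd (z.re + 2 * z.im) 5
  push_cast at h
  rw [primeFive, RingHom.mem_ker, homOfRoot_apply, ← h, mul_comm]

instance : Fact (Nat.Prime 5) := ⟨by norm_num⟩
instance : Fact (Nat.Prime 7) := ⟨by norm_num⟩

lemma primeSeven_isPrime : primeSeven.IsPrime := ker_homOfRoot_isPrime 7 3 _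
lemma primeFive_isPrime : primeFive.IsPrime := ker_homOfRoot_isPrime 5 2 _
lemma primeSeven_ne_bot : primeSeven ≠ ⊥ := ker_homOfRoot_ne_bot 7 3 _
lemma primeFive_ne_bot : primeFive ≠ ⊥ := ker_homOfRoot_ne_bot 5 2 _

lemma cubicRootless_primeSeven : CubicRootless (IntQuad31 ⧸ primeSeven) :=
  cubicRootless_quotient_ker _ (by unfold CubicRootless; decide)

lemma cubicRootless_primeFive : CubicRootless (IntQuad31 ⧸ primeFive) :=
  cubicRootless_quotient_ker _ (by unfold CubicRootless; decide)

lemma not_isPrincipal_primeSeven : ¬ primeSeven.IsPrincipal := by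
  intro h
  obtain ⟨d, hd⟩ := h.exists_span
  have hdm : d ∈ primeSeven := by rw [hd]; exact Ideal.mem_span_singleton_self d
  have h1 : Ideal.absNorm primeSeven ∣ 14 := by
    have := absNorm_dvd_norm (b := ⟨-3, 1⟩) ((mem_primeSeven _).2 (by norm_num))
    rwa [norm_eq] at this
  have h2 : Ideal.absNorm primeSeven ∣ 49 := by
    have := absNorm_dvd_norm (b := ⟨7, 0⟩) ((mem_primeSeven _).2 (by norm_num))
    rwa [norm_eq] at this
  have h3 : Ideal.absNorm primeSeven ∣ 7 := (Nat.dvd_gcd h1 h2).trans (by norm_num)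
  have h4 : Ideal.absNorm primeSeven = 7 := by
    refine ((Nat.dvd_prime (by norm_num)).1 h3).resolve_left fun h => ?_
    exact primeSeven_isPrime.ne_top (Ideal.absNorm_eq_one_iff.1 h)
  rw [hd, absNorm_span] at h4
  have h5 : d.norm = 7 := by
    have := norm_nonneg d
    omega
  rw [norm_eq] at h5
  have h6 : d.im = 0 := by
    by_contra h0
    have := Int.one_le_abs h0
    have h7 : 1 ≤ d.im ^ 2 := by rw [← sq_abs]; nlinarith
    nlinarith [sq_nonneg (2 * d.re + d.im)]
  rw [h6] at h5
  have h7 : d.re ^ 2 = 7 := by linarith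
  have h8 : d.re ≤ 2 := by nlinarith
  have h9 : -2 ≤ d.re := by nlinarith
  interval_cases d.re <;> omega

lemma ordAt_primeSeven_seven : ordAt primeSeven (7 : IntQuad31) = 1 := by
  have h7 : (7 : IntQuad31) ≠ 0 := by
    intro h
    have := congrArg QuadraticAlgebra.re h
    simp at this
  have h1 := (mem_pow_iff_le_ordAt primeSeven_isPrime primeSeven_ne_bot h7 1).1
    (by rw [pow_one, mem_primeSeven]; simp)
  have h2 : ¬ 2 ≤ ordAt primeSeven (7 : IntQuad31) := by
    rw [← mem_pow_iff_le_ordAt primeSeven_isPrime primeSeven_ne_bot h7, pow_two]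
    intro h
    have hle : primeSeven * primeSeven ≤ RingHom.ker (homOfRoot (10 : ZMod 49) (by decide)) := by
      rw [Ideal.mul_le]
      intro a ha b hb
      rw [mem_primeSeven] at ha hb
      obtain ⟨i, hi⟩ := ha
      obtain ⟨j, hj⟩ := hb
      have h49 : (49 : ZMod 49) = 0 := by decide
      have hi' : ((a.re : ℤ) : ZMod 49) = 7 * i - 3 * a.im := by
        rw [show a.re = 7 * i - 3 * a.im by linarith]; push_cast; ring
      have hj' : ((b.re : ℤ) : ZMod 49) = 7 * j - 3 * b.im := by
        rw [show b.re = 7 * j - 3 * b.im by linarith]; push_cast; ring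
      rw [RingHom.mem_ker, map_mul, homOfRoot_apply, homOfRoot_apply, hi', hj']
      linear_combination ((i : ZMod 49) + a.im) * (j + b.im) * h49
    have := hle h
    rw [RingHom.mem_ker, map_ofNat] at this
    exact absurd this (by decide)
  omega

lemma eq_primeSeven {P : Ideal IntQuad31} (hP : P.IsPrime) (h7 : (7 : IntQuad31) ∈ P)
    (ht : theta ∈ P) : P = primeSeven := by
  have hmax := primeSeven_isPrime.isMaximal primeSeven_ne_bot
  refine (hmax.eq_of_le hP.ne_top fun z hz => ?_).symm
  obtain ⟨k, hk⟩ := (mem_primeSeven z).1 hz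
  have : z = ((k : IntQuad31) - z.im * (1 + ⟨0, 1⟩)) * 7 + 4 * z.im * theta := by
    ext
    · simp [theta]; linarith
    · simp [theta]; ring
  rw [this]
  exact add_mem (Ideal.mul_mem_left _ _ h7) (Ideal.mul_mem_left _ _ ht)

/-- The descent at a prime without roots in its residue field. -/
lemma ordAt_factor {P : Ideal IntQuad31} (hP : P.IsPrime) (hP0 : P ≠ ⊥)
    (hroot : CubicRootless (IntQuad31 ⧸ P)) {x₀ z w g : ℤ} {c : IntQuad31} (hg : g ≠ 0) (hc : c ≠ 0)
    (h : cubicNorm ((g * x₀ : ℤ) : IntQuad31) z w = (g : IntQuad31) ^ 3 * c) :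
    3 ∣ ordAt P c ∧ (c ∈ P → (x₀ : IntQuad31) ∈ P) := by
  have hg' : (g : IntQuad31) ≠ 0 := by exact_mod_cast hg
  have hne : ¬(((g * x₀ : ℤ) : IntQuad31) = 0 ∧ (z : IntQuad31) = 0 ∧ (w : IntQuad31) = 0) := by
    rintro ⟨h1, h2, h3⟩
    rw [h1, h2, h3] at h
    have : (g : IntQuad31) ^ 3 * c = 0 := by rw [← h]; simp [cubicNorm]
    exact mul_ne_zero (pow_ne_zero 3 hg') hc this
  obtain ⟨-, m, ⟨hX, -, -⟩, hm⟩ := ordAt_cubicNorm hP hP0 hroot hne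
  rw [h, ordAt_mul P (pow_ne_zero 3 hg') hc, ordAt_pow P hg'] at hm
  refine ⟨by omega, fun hcP => ?_⟩
  have h1 := (ordAt_pos hP hP0 hc).1 hcP
  by_cases hx : (x₀ : IntQuad31) = 0
  · rw [hx]; exact P.zero_mem
  · push_cast at hX
    rw [mem_pow_iff_le_ordAt hP hP0 (mul_ne_zero hg' hx), ordAt_mul P hg' hx] at hX
    rw [ordAt_pos hP hP0 hx]
    omega

theorem no_primitive_solution {x y z w : ℤ} (hne : ¬(x = 0 ∧ y = 0 ∧ z = 0 ∧ w = 0))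
    (h : cubicNorm x z w = 175 * y * (x ^ 2 + 4 * x * y + 35 * y ^ 2)) : False := by
  have hcast : ∀ n : ℤ, (n : IntQuad31) = 0 → n = 0 := fun n hn => by exact_mod_cast hn
  have hy : y ≠ 0 := by
    rintro rfl
    have h1 : ¬((x : IntQuad31) = 0 ∧ (z : IntQuad31) = 0 ∧ (w : IntQuad31) = 0) := fun h2 =>
      hne ⟨hcast _ h2.1, rfl, hcast _ h2.2.1, hcast _ h2.2.2⟩
    apply cubicNorm_ne_zero h1
    have h2 := congrArg (Int.castRingHom IntQuad31) h
    rw [map_cubicNorm] at h2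
    simpa using h2
  obtain ⟨g, x₀, y₀, hg, hcop, rfl, rfl⟩ : ∃ g x₀ y₀ : ℤ, g ≠ 0 ∧ IsCoprime x₀ y₀ ∧
      x = g * x₀ ∧ y = g * y₀ := by
    obtain ⟨x₀, hx₀⟩ := Int.gcd_dvd_left x y
    obtain ⟨y₀, hy₀⟩ := Int.gcd_dvd_right x y
    have hg : 0 < Int.gcd x y := Int.gcd_pos_of_ne_zero_right x hy
    refine ⟨Int.gcd x y, x₀, y₀, by omega, ?_, hx₀, hy₀⟩
    rw [Int.isCoprime_iff_gcd_eq_one]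
    have h1 := Int.gcd_mul_left (Int.gcd x y) x₀ y₀
    rw [← hx₀, ← hy₀, Int.natAbs_natCast] at h1
    exact (Nat.eq_of_mul_eq_mul_left hg ((mul_one _).trans h1)).symm
  have hy₀ : y₀ ≠ 0 := right_ne_zero_of_mul hy
  have hcopP : ∀ P : Ideal IntQuad31, P.IsPrime → (x₀ : IntQuad31) ∈ P → (y₀ : IntQuad31) ∉ P := by
    intro P hP hx hy
    obtain ⟨a, b, hab⟩ := hcop
    apply hP.ne_top
    rw [Ideal.eq_top_iff_one]
    have : (1 : IntQuad31) = a * x₀ + b * y₀ := by exact_mod_cast hab.symm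
    rw [this]
    exact add_mem (Ideal.mul_mem_left _ _ hx) (Ideal.mul_mem_left _ _ hy)
  have hmain : cubicNorm ((g * x₀ : ℤ) : IntQuad31) z w
      = (g : IntQuad31) ^ 3 * (175 * y₀ * (x₀ + theta * y₀) * (x₀ + thetaConj * y₀)) := by
    have h2 := congrArg (Int.castRingHom IntQuad31) h
    rw [map_cubicNorm] at h2
    simp only [eq_intCast] at h2
    rw [h2]
    push_cast
    linear_combination (-175 * (g : IntQuad31) ^ 3 * y₀ ^ 2 * x₀) * theta_add_thetaConj
      - (175 * (g : IntQuad31) ^ 3 * y₀ ^ 3) * theta_mul_thetaConj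
  have hy₀' : (y₀ : IntQuad31) ≠ 0 := fun h0 => hy₀ (hcast _ h0)
  have hb : ∀ t : IntQuad31, t.im ≠ 0 → (x₀ : IntQuad31) + t * y₀ ≠ 0 := fun t ht h0 =>
    hy₀ (intCast_add_intCast_mul_eq_zero ht h0)
  have h175 : (175 : IntQuad31) ≠ 0 := fun h0 => absurd (hcast 175 (by exact_mod_cast h0)) (by norm_num)
  have hc0 : (175 * y₀ * (x₀ + theta * y₀) * (x₀ + thetaConj * y₀) : IntQuad31) ≠ 0 :=
    mul_ne_zero (mul_ne_zero (mul_ne_zero h175 hy₀') (hb _ (by simp [theta])))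
      (hb _ (by simp [thetaConj]))
  have hx5 : (5 : ℤ) ∣ x₀ := by
    have := (ordAt_factor primeFive_isPrime primeFive_ne_bot cubicRootless_primeFive hg hc0
      hmain).2 (by
        rw [mul_assoc, mul_assoc]
        exact Ideal.mul_mem_right _ _ ((mem_primeFive _).2 (by norm_num)))
    simpa [mem_primeFive] using this
  have hx7 : (7 : ℤ) ∣ x₀ := by
    have := (ordAt_factor primeSeven_isPrime primeSeven_ne_bot cubicRootless_primeSeven hg hc0
      hmain).2 (by
        rw [mul_assoc, mul_assoc]
        exact Ideal.mul_mem_right _ _ ((mem_primeSeven _).2 (by norm_num)))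
    simpa [mem_primeSeven] using this
  obtain ⟨x', rfl⟩ : (35 : ℤ) ∣ x₀ := by omega
  -- the two conjugate factors after removing `theta` and its conjugate
  set b : IntQuad31 := y₀ + thetaConj * x' with hbdef
  set b' : IntQuad31 := y₀ + theta * x' with hbdef'
  have hfac : (175 * y₀ * ((35 * x' : ℤ) + theta * y₀) * ((35 * x' : ℤ) + thetaConj * y₀)
      : IntQuad31) = 5 ^ 3 * 7 ^ 2 * y₀ * b * b' := by
    have e1 : ((35 * x' : ℤ) : IntQuad31) + theta * y₀ = theta * b := by
      rw [hbdef]; push_cast; linear_combination (-(x' : IntQuad31)) * theta_mul_thetaConj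
    have e2 : ((35 * x' : ℤ) : IntQuad31) + thetaConj * y₀ = thetaConj * b' := by
      rw [hbdef']; push_cast; linear_combination (-(x' : IntQuad31)) * theta_mul_thetaConj
    rw [e1, e2]
    linear_combination (175 * y₀ * b * b') * theta_mul_thetaConj
  rw [hfac] at hmain hc0
  have hb0 : b ≠ 0 := fun h0 => hc0 (by rw [h0]; ring)
  have hb'0 : b' ≠ 0 := fun h0 => hc0 (by rw [h0]; ring)
  have h5 : (5 : IntQuad31) ≠ 0 := fun h0 => hc0 (by rw [h0]; ring)
  have h7 : (7 : IntQuad31) ≠ 0 := fun h0 => hc0 (by rw [h0]; ring)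
  have hord : ∀ P : Ideal IntQuad31, P.IsPrime → P ≠ ⊥ → CubicRootless (IntQuad31 ⧸ P) →
      ((35 * x' : ℤ) : IntQuad31) ∈ P → theta ∈ P → 3 ∣ 2 * ordAt P 7 + ordAt P b := by
    intro P hP hP0 hroot hx ht
    have hyP := hcopP P hP hx
    have hb'P : b' ∉ P := fun hmem => hyP (by
      have := sub_mem hmem (Ideal.mul_mem_right (x' : IntQuad31) _ ht)
      rwa [hbdef', add_sub_cancel_right] at this)
    have h3 := (ordAt_factor hP hP0 hroot hg hc0 hmain).1
    rw [ordAt_mul P (left_ne_zero_of_mul hc0) hb'0,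
      ordAt_mul P (left_ne_zero_of_mul (left_ne_zero_of_mul hc0)) hb0,
      ordAt_mul P (mul_ne_zero (pow_ne_zero 3 h5) (pow_ne_zero 2 h7)) hy₀',
      ordAt_mul P (pow_ne_zero 3 h5) (pow_ne_zero 2 h7), ordAt_pow P h5, ordAt_pow P h7,
      ordAt_eq_zero hP hP0 hyP, ordAt_eq_zero hP hP0 hb'P] at h3
    omega
  have hmod : ordAt primeSeven b % 3 = 1 := by
    have := hord primeSeven primeSeven_isPrime primeSeven_ne_bot cubicRootless_primeSeven
      ((mem_primeSeven _).2 (by simp; omega)) ((mem_primeSeven _).2 (by norm_num [theta]))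
    rw [ordAt_primeSeven_seven] at this
    omega
  refine not_isPrincipal_primeSeven (Submodule.IsPrincipal.of_pow_modEq_one primeSeven_ne_bot
    (isPrincipal_cube primeSeven_isPrime primeSeven_ne_bot) hmod (isPrincipal_pow_ordAt hb0 ?_))
  intro Q hQ hQ0 hQ7 hbQ
  by_cases hroot : CubicRootless (IntQuad31 ⧸ Q)
  · refine (isPrincipal_cube hQ hQ0).pow_of_three_dvd ?_
    have hx := (ordAt_factor hQ hQ0 hroot hg hc0 hmain).2
      (Ideal.mul_mem_right _ _ (Ideal.mul_mem_left _ _ hbQ))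
    have hyQ := hcopP Q hQ hx
    have ht : theta ∈ Q := by
      have h1 : theta * (y₀ : IntQuad31) = theta * b - ((35 * x' : ℤ) : IntQuad31) := by
        rw [hbdef]; push_cast; linear_combination (-(x' : IntQuad31)) * theta_mul_thetaConj
      have h2 : theta * (y₀ : IntQuad31) ∈ Q := by
        rw [h1]; exact sub_mem (Ideal.mul_mem_left _ _ hbQ) hx
      exact (hQ.mem_or_mem h2).resolve_right hyQ
    have h35 : (5 : IntQuad31) * 7 ∈ Q := by
      have : (5 : IntQuad31) * 7 = theta * thetaConj := by rw [theta_mul_thetaConj]; norm_num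
      rw [this]; exact Ideal.mul_mem_right _ _ ht
    have h7Q : (7 : IntQuad31) ∉ Q := fun h7Q => hQ7 (eq_primeSeven hQ h7Q ht)
    have h3 := hord Q hQ hQ0 hroot hx ht
    rw [ordAt_eq_zero hQ hQ0 h7Q] at h3
    simpa using h3
  · exact (isPrincipal_of_root hQ hQ0 hroot).pow_ideal _

end IntQuad31

theorem no_rational_solution {x y z w : ℚ} (hne : ¬(x = 0 ∧ y = 0 ∧ z = 0 ∧ w = 0))
    (h : cubicNorm x z w = 175 * y * (x ^ 2 + 4 * x * y + 35 * y ^ 2)) : False := by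
  have hx := x.mul_den_eq_num
  have hy := y.mul_den_eq_num
  have hz := z.mul_den_eq_num
  have hw := w.mul_den_eq_num
  have hx0 : (x.den : ℚ) ≠ 0 := by exact_mod_cast x.den_ne_zero
  have hy0 : (y.den : ℚ) ≠ 0 := by exact_mod_cast y.den_ne_zero
  have hz0 : (z.den : ℚ) ≠ 0 := by exact_mod_cast z.den_ne_zero
  have hw0 : (w.den : ℚ) ≠ 0 := by exact_mod_cast w.den_ne_zero
  set d : ℚ := x.den * y.den * z.den * w.den with hd
  have hd0 : d ≠ 0 := by positivity
  have hX : ((x.num * y.den * z.den * w.den : ℤ) : ℚ) = d * x := by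
    push_cast; rw [← hx, hd]; ring
  have hY : ((x.den * y.num * z.den * w.den : ℤ) : ℚ) = d * y := by
    push_cast; rw [← hy, hd]; ring
  have hZ : ((x.den * y.den * z.num * w.den : ℤ) : ℚ) = d * z := by
    push_cast; rw [← hz, hd]; ring
  have hW : ((x.den * y.den * z.den * w.num : ℤ) : ℚ) = d * w := by
    push_cast; rw [← hw, hd]; ring
  refine IntQuad31.no_primitive_solution (x := x.num * y.den * z.den * w.den)
    (y := x.den * y.num * z.den * w.den) (z := x.den * y.den * z.num * w.den)
    (w := x.den * y.den * z.den * w.num) ?_ ?_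
  · rintro ⟨h1, h2, h3, h4⟩
    rw [h1, Int.cast_zero, eq_comm, mul_eq_zero, or_iff_right hd0] at hX
    rw [h2, Int.cast_zero, eq_comm, mul_eq_zero, or_iff_right hd0] at hY
    rw [h3, Int.cast_zero, eq_comm, mul_eq_zero, or_iff_right hd0] at hZ
    rw [h4, Int.cast_zero, eq_comm, mul_eq_zero, or_iff_right hd0] at hW
    exact hne ⟨hX, hY, hZ, hW⟩
  · have key : (cubicNorm (d * x) (d * z) (d * w) : ℚ)
        = 175 * (d * y) * ((d * x) ^ 2 + 4 * (d * x) * (d * y) + 35 * (d * y) ^ 2) := by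
      rw [cubicNorm_smul, h]; ring
    rw [← hX, ← hY, ← hZ, ← hW] at key
    have h2 := map_cubicNorm (Int.castRingHom ℚ) (x.num * y.den * z.den * w.den)
      (x.den * y.den * z.num * w.den) (x.den * y.den * z.den * w.num)
    simp only [eq_intCast] at h2
    rw [← h2] at key
    exact_mod_cast key

section LocalSolubility

lemma exists_root_toZMod {p : ℕ} [Fact p.Prime] (c₀ c₁ c₂ c₃ : ℤ_[p]) (a : ZMod p)
    (h : PadicInt.toZMod c₀ + PadicInt.toZMod c₁ * a + PadicInt.toZMod c₂ * a ^ 2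
      + PadicInt.toZMod c₃ * a ^ 3 = 0)
    (h' : PadicInt.toZMod c₁ + 2 * PadicInt.toZMod c₂ * a + 3 * PadicInt.toZMod c₃ * a ^ 2 ≠ 0) :
    ∃ t : ℤ_[p], c₀ + c₁ * t + c₂ * t ^ 2 + c₃ * t ^ 3 = 0 ∧ PadicInt.toZMod t = a := by
  have hlt : ∀ x : ℤ_[p], ‖x‖ < 1 ↔ PadicInt.toZMod x = 0 := fun x => by
    rw [← RingHom.mem_ker, PadicInt.ker_toZMod, IsLocalRing.mem_maximalIdeal, PadicInt.mem_nonunits]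
  obtain ⟨a, rfl⟩ := ZMod.ringHom_surjective (PadicInt.toZMod (p := p)) a
  let F : Polynomial ℤ_[p] := Polynomial.C c₀ + Polynomial.C c₁ * Polynomial.X
    + Polynomial.C c₂ * Polynomial.X ^ 2 + Polynomial.C c₃ * Polynomial.X ^ 3
  have hF : ∀ t, Polynomial.aeval t F = c₀ + c₁ * t + c₂ * t ^ 2 + c₃ * t ^ 3 := fun t => by
    simp [F]
  have hF' : ∀ t, Polynomial.aeval t (Polynomial.derivative F) = c₁ + 2 * c₂ * t + 3 * c₃ * t ^ 2 :=
    fun t => by simp [F]; ring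
  have h1 : ‖Polynomial.aeval a (Polynomial.derivative F)‖ = 1 := by
    refine le_antisymm (PadicInt.norm_le_one _) (not_lt.1 fun hn => h' ?_)
    rw [hlt, hF'] at hn
    simpa [map_ofNat] using hn
  obtain ⟨t, ht, hta, -⟩ := hensels_lemma (F := F) (a := a) (by
    rw [h1, one_pow, hlt, hF]
    simpa using h)
  refine ⟨t, (hF t).symm.trans ht, ?_⟩
  rw [h1, hlt, map_sub, sub_eq_zero] at hta
  exact hta

/-- A nonsingular point modulo `p` of a surface `N(x, z, w) = y (α x² + β x y + γ y²)` lifts to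
`ℤ_p`. -/
lemma exists_padic_lift {p : ℕ} [Fact p.Prime] (α β γ : ℤ) {x y z w : ZMod p}
    (hne : ¬(x = 0 ∧ y = 0 ∧ z = 0 ∧ w = 0))
    (h : cubicNorm x z w = y * (α * x ^ 2 + β * x * y + γ * y ^ 2))
    (hns : ¬(3 * x ^ 2 - 4 * x * w + z ^ 2 + 3 * z * w + w ^ 2 = y * (2 * α * x + β * y) ∧
      α * x ^ 2 + 2 * β * x * y + 3 * γ * y ^ 2 = 0 ∧
      2 * x * z + 3 * x * w - 3 * z ^ 2 - w ^ 2 = 0 ∧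
      -2 * x ^ 2 + 3 * x * z + 2 * x * w - 2 * z * w + 3 * w ^ 2 = 0)) :
    ∃ X Y Z W : ℤ_[p], ¬(X = 0 ∧ Y = 0 ∧ Z = 0 ∧ W = 0) ∧
      cubicNorm X Z W = Y * (α * X ^ 2 + β * X * Y + γ * Y ^ 2) := by
  suffices ∃ X Y Z W : ℤ_[p], (PadicInt.toZMod X = x ∧ PadicInt.toZMod Y = y ∧
      PadicInt.toZMod Z = z ∧ PadicInt.toZMod W = w) ∧
      cubicNorm X Z W = Y * (α * X ^ 2 + β * X * Y + γ * Y ^ 2) by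
    obtain ⟨X, Y, Z, W, ⟨rfl, rfl, rfl, rfl⟩, h1⟩ := this
    refine ⟨X, Y, Z, W, fun h0 => hne ?_, h1⟩
    simp [h0]
  obtain ⟨X, hX⟩ := ZMod.ringHom_surjective (PadicInt.toZMod (p := p)) x
  obtain ⟨Y, hY⟩ := ZMod.ringHom_surjective (PadicInt.toZMod (p := p)) y
  obtain ⟨Z, hZ⟩ := ZMod.ringHom_surjective (PadicInt.toZMod (p := p)) z
  obtain ⟨W, hW⟩ := ZMod.ringHom_surjective (PadicInt.toZMod (p := p)) w
  unfold cubicNorm at h ⊢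
  by_cases h1 : 3 * x ^ 2 - 4 * x * w + z ^ 2 + 3 * z * w + w ^ 2 = y * (2 * α * x + β * y)
  · by_cases h2 : α * x ^ 2 + 2 * β * x * y + 3 * γ * y ^ 2 = 0
    · by_cases h3 : 2 * x * z + 3 * x * w - 3 * z ^ 2 - w ^ 2 = 0
      · obtain ⟨t, ht, hta⟩ := exists_root_toZMod (p := p)
          (X ^ 3 + X * Z ^ 2 - Z ^ 3 - Y * (α * X ^ 2 + β * X * Y + γ * Y ^ 2))
          (3 * X * Z - 2 * X ^ 2) (X - Z) 1 w
          (by simp [hX, hY, hZ, map_ofNat]; linear_combination h)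
          (fun h0 => hns ⟨h1, h2, h3, by
            simp [hX, hZ, map_ofNat] at h0; linear_combination h0⟩)
        exact ⟨X, Y, Z, t, ⟨hX, hY, hZ, hta⟩, by linear_combination ht⟩
      · obtain ⟨t, ht, hta⟩ := exists_root_toZMod (p := p)
          (X ^ 3 - 2 * X ^ 2 * W + X * W ^ 2 + W ^ 3 - Y * (α * X ^ 2 + β * X * Y + γ * Y ^ 2))
          (3 * X * W - W ^ 2) X (-1) z
          (by simp [hX, hY, hW, map_ofNat]; linear_combination h)
          (fun h0 => h3 (by simp [hX, hW, map_ofNat] at h0; linear_combination h0))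
        exact ⟨X, Y, t, W, ⟨hX, hY, hta, hW⟩, by linear_combination ht⟩
    · obtain ⟨t, ht, hta⟩ := exists_root_toZMod (p := p)
        (X ^ 3 - 2 * X ^ 2 * W + X * Z ^ 2 + 3 * X * Z * W + X * W ^ 2 - Z ^ 3 - Z * W ^ 2 + W ^ 3)
        (-(α * X ^ 2)) (-(β * X)) (-γ) y
        (by simp [hX, hZ, hW, map_ofNat]; linear_combination h)
        (fun h0 => h2 (by simp [hX] at h0; linear_combination -h0))
      exact ⟨X, t, Z, W, ⟨hX, hta, hZ, hW⟩, by linear_combination ht⟩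
  · obtain ⟨t, ht, hta⟩ := exists_root_toZMod (p := p)
      (-Z ^ 3 - Z * W ^ 2 + W ^ 3 - γ * Y ^ 3)
      (Z ^ 2 + 3 * Z * W + W ^ 2 - β * Y ^ 2) (-2 * W - α * Y) 1 x
      (by simp [hY, hZ, hW, map_ofNat]; linear_combination h)
      (fun h0 => h1 (by simp [hY, hZ, hW, map_ofNat] at h0; linear_combination h0))
    exact ⟨t, Y, Z, W, ⟨hta, hY, hZ, hW⟩, by linear_combination ht⟩

/-- Chevalley–Warning for the surfaces `N(x, z, w) = y (α x² + β x y + γ y²)`. -/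
lemma exists_zmod_point (p : ℕ) [Fact p.Prime] (α β γ : ZMod p) :
    ∃ x y z w : ZMod p, ¬(x = 0 ∧ y = 0 ∧ z = 0 ∧ w = 0) ∧
      cubicNorm x z w = y * (α * x ^ 2 + β * x * y + γ * y ^ 2) := by
  open MvPolynomial in
  classical
  let F : MvPolynomial (Fin 4) (ZMod p) := cubicNorm (X 0) (X 2) (X 3)
    - X 1 * (C α * X 0 ^ 2 + C β * X 0 * X 1 + C γ * X 1 ^ 2)
  have hm : ∀ (c : ZMod p) (i j k : Fin 4),
      c • (X i * X j * X k : MvPolynomial (Fin 4) (ZMod p)) ∈ restrictTotalDegree (Fin 4) (ZMod p) 3 := by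
    intro c i j k
    refine Submodule.smul_mem _ _ ?_
    rw [mem_restrictTotalDegree]
    refine (totalDegree_mul _ _).trans ?_
    have := totalDegree_mul (X i : MvPolynomial (Fin 4) (ZMod p)) (X j)
    simp only [totalDegree_X] at this ⊢
    omega
  have hF : F ∈ restrictTotalDegree (Fin 4) (ZMod p) 3 := by
    have : F = (1 : ZMod p) • (X 0 * X 0 * X 0) + (-2 : ZMod p) • (X 0 * X 0 * X 3)
        + (1 : ZMod p) • (X 0 * X 2 * X 2) + (3 : ZMod p) • (X 0 * X 2 * X 3)
        + (1 : ZMod p) • (X 0 * X 3 * X 3) + (-1 : ZMod p) • (X 2 * X 2 * X 2)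
        + (-1 : ZMod p) • (X 2 * X 3 * X 3) + (1 : ZMod p) • (X 3 * X 3 * X 3)
        + (-α) • (X 0 * X 0 * X 1) + (-β) • (X 0 * X 1 * X 1) + (-γ) • (X 1 * X 1 * X 1) := by
      simp only [F, cubicNorm, smul_eq_C_mul, C_neg, C_1, map_ofNat]
      ring
    rw [this]
    iterate 10 refine add_mem ?_ (hm _ _ _ _)
    exact hm _ _ _ _
  rw [mem_restrictTotalDegree] at hF
  have hdvd := char_dvd_card_solutions p (f := F) (by rw [Fintype.card_fin]; omega)
  have heval : ∀ v : Fin 4 → ZMod p, eval v F = cubicNorm (v 0) (v 2) (v 3)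
      - v 1 * (α * v 0 ^ 2 + β * v 0 * v 1 + γ * v 1 ^ 2) := by
    intro v
    simp [F, map_cubicNorm]
  have h0 : eval 0 F = 0 := by rw [heval]; simp [cubicNorm]
  have hcard : 1 < Fintype.card {v : Fin 4 → ZMod p // eval v F = 0} :=
    (Fact.out : p.Prime).one_lt.trans_le (Nat.le_of_dvd (Fintype.card_pos_iff.2 ⟨⟨0, h0⟩⟩) hdvd)
  obtain ⟨⟨v, hv⟩, hne⟩ := Fintype.exists_ne_of_one_lt_card hcard ⟨0, h0⟩
  refine ⟨v 0, v 1, v 2, v 3, fun h => hne ?_, ?_⟩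
  · ext i
    fin_cases i
    exacts [h.1, h.2.1, h.2.2.1, h.2.2.2]
  · rw [heval] at hv
    exact sub_eq_zero.1 hv

end LocalSolubility

section LocalSolubility

instance : Fact (Nat.Prime 31) := ⟨by norm_num⟩
instance : Fact (Nat.Prime 7127) := ⟨by norm_num⟩

lemma exists_point_of_root {F : Type*} [CommRing F] [Nontrivial F] {r : F} (hr : r ^ 3 + r + 1 = 0) :
    ∃ x y z w : F, ¬(x = 0 ∧ y = 0 ∧ z = 0 ∧ w = 0) ∧
      cubicNorm x z w = 175 * y * (x ^ 2 + 4 * x * y + 35 * y ^ 2) :=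
  ⟨-r, 0, 1, 0, by simp, by unfold cubicNorm; linear_combination -hr⟩

lemma exists_real_root : ∃ r : ℝ, r ^ 3 + r + 1 = 0 := by
  have hc : ContinuousOn (fun r : ℝ => r ^ 3 + r + 1) (Set.Icc (-1) 0) := by fun_prop
  obtain ⟨r, -, hr⟩ := intermediate_value_Icc (by norm_num) hc
    (show (0 : ℝ) ∈ Set.Icc _ _ by constructor <;> norm_num)
  exact ⟨r, hr⟩

lemma exists_padic_root {p : ℕ} [Fact p.Prime] {a : ZMod p} (ha : a ^ 3 + a + 1 = 0)
    (h31 : (31 : ZMod p) ≠ 0) : ∃ r : ℤ_[p], r ^ 3 + r + 1 = 0 := by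
  obtain ⟨t, ht, -⟩ := exists_root_toZMod (p := p) 1 1 0 1 a
    (by simp; linear_combination ha) (fun h => h31 (by
      simp at h
      linear_combination 4 * h - 3 * (2 * a - 3) * (3 * ha - a * h)))
  exact ⟨t, by linear_combination ht⟩

lemma partials_zero_imp {F : Type*} [Field F] (hF : CubicRootless F) (h5 : (5 : F) ≠ 0)
    (h7 : (7 : F) ≠ 0) (h2 : (2 : F) ≠ 0) (h7127 : (7127 : F) ≠ 0) {x y z w : F}
    (hne : ¬(x = 0 ∧ y = 0 ∧ z = 0 ∧ w = 0))
    (h : cubicNorm x z w = y * (175 * x ^ 2 + 700 * x * y + 6125 * y ^ 2))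
    (hx : 3 * x ^ 2 - 4 * x * w + z ^ 2 + 3 * z * w + w ^ 2 = y * (2 * 175 * x + 700 * y))
    (hy : 175 * x ^ 2 + 2 * 700 * x * y + 3 * 6125 * y ^ 2 = 0)
    (hz : 2 * x * z + 3 * x * w - 3 * z ^ 2 - w ^ 2 = 0)
    (hw : -2 * x ^ 2 + 3 * x * z + 2 * x * w - 2 * z * w + 3 * w ^ 2 = 0) : False := by
  have h3 : (3 : F) ≠ 0 := fun h => hF 1 (by linear_combination h)
  have h31 : (31 : F) ≠ 0 := fun h => hF 3 (by linear_combination h)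
  have hN : cubicNorm x z w ≠ 0 := by
    intro hN
    obtain ⟨rfl, rfl, rfl⟩ := hF.eq_zero_of_cubicNorm_eq_zero hN
    have : 5 ^ 3 * 7 ^ 2 * y ^ 3 = 0 := by rw [hN] at h; linear_combination -h
    simp [h5, h7] at this
    exact hne ⟨rfl, this, rfl, rfl⟩
  have hw0 : w = 0 := by
    have : cubicNorm x z w * (2 * w) = 0 := by
      unfold cubicNorm
      linear_combination (w ^ 2 + x * z) * hz + (w ^ 2 + z ^ 2 - x * w) * hw
    simpa [hN, h2] using this
  have hxz : 2 * x = 3 * z := by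
    have : cubicNorm x z w * (2 * x - 3 * z) = 0 := by
      unfold cubicNorm
      linear_combination (-z ^ 2 + x * w + x * z) * hz + (-z * w + x * w - x ^ 2) * hw
    exact sub_eq_zero.1 (by simpa [hN] using this)
  subst hw0
  obtain ⟨s, rfl, rfl⟩ : ∃ s, x = 3 * s ∧ z = 2 * s :=
    ⟨x - z, by linear_combination -hxz, by linear_combination -hxz⟩
  have hs : s ≠ 0 := by
    rintro rfl
    simp [cubicNorm] at hN
  have hq : 3 * s ^ 2 + 8 * s * y + 35 * y ^ 2 = 0 := by
    have : 5 ^ 2 * 7 * 3 * (3 * s ^ 2 + 8 * s * y + 35 * y ^ 2) = 0 := by linear_combination hy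
    simpa [h5, h7, h3] using this
  have hl : 91 * s = 890 * y := by
    refine mul_left_cancel₀ hs ?_
    linear_combination hx + 20 * hq
  have hfin : 3 * 5 * 31 * 7127 * s ^ 2 = 0 := by
    linear_combination 890 ^ 2 * hq + (8 * 890 * s + 35 * (91 * s + 890 * y)) * hl
  simp [h3, h5, h31, h7127, hs] at hfin

theorem exists_padic_point (p : ℕ) [hp : Fact p.Prime] :
    ∃ x y z w : ℚ_[p], ¬(x = 0 ∧ y = 0 ∧ z = 0 ∧ w = 0) ∧
      cubicNorm x z w = 175 * y * (x ^ 2 + 4 * x * y + 35 * y ^ 2) := by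
  suffices ∃ x y z w : ℤ_[p], ¬(x = 0 ∧ y = 0 ∧ z = 0 ∧ w = 0) ∧
      cubicNorm x z w = 175 * y * (x ^ 2 + 4 * x * y + 35 * y ^ 2) by
    obtain ⟨x, y, z, w, hne, h⟩ := this
    refine ⟨x, y, z, w, by simpa only [PadicInt.coe_eq_zero] using hne, ?_⟩
    have h1 := congrArg (PadicInt.Coe.ringHom (p := p)) h
    rw [map_cubicNorm] at h1
    simp only [map_mul, map_add, map_pow, map_ofNat] at h1
    exact h1
  have hcast : ∀ q : ℕ, q.Prime → (q : ZMod p) = 0 → p = q := fun q hq h =>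
    (Nat.prime_dvd_prime_iff_eq hp.out hq).1 ((ZMod.natCast_eq_zero_iff q p).1 h)
  have hlift : ∀ x y z w : ℤ_[p], ¬(x = 0 ∧ y = 0 ∧ z = 0 ∧ w = 0) →
      cubicNorm x z w = y * ((175 : ℤ) * x ^ 2 + (700 : ℤ) * x * y + (6125 : ℤ) * y ^ 2) →
      ∃ x y z w : ℤ_[p], ¬(x = 0 ∧ y = 0 ∧ z = 0 ∧ w = 0) ∧
      cubicNorm x z w = 175 * y * (x ^ 2 + 4 * x * y + 35 * y ^ 2) := fun x y z w hne h =>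
    ⟨x, y, z, w, hne, by push_cast at h; linear_combination h⟩
  by_cases hroot : CubicRootless (ZMod p)
  · have h31 : p ≠ 31 := by
      rintro rfl
      obtain rfl : hp = ⟨by norm_num⟩ := rfl
      exact hroot 3 (by decide)
    rcases eq_or_ne p 2 with rfl | h2
    · obtain rfl : hp = ⟨by norm_num⟩ := rfl
      obtain ⟨X, Y, Z, W, hne, h⟩ := exists_padic_lift (p := 2) 175 700 6125
        (x := 0) (y := 1) (z := 0) (w := 1) (by decide) (by decide) (by decide)
      exact hlift X Y Z W hne h
    rcases eq_or_ne p 5 with rfl | h5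
    · obtain rfl : hp = ⟨by norm_num⟩ := rfl
      obtain ⟨X, Y, Z, W, hne, h⟩ := exists_padic_lift (p := 5) 35 28 49
        (x := 0) (y := 1) (z := 0) (w := 4) (by decide) (by decide) (by decide)
      refine ⟨5 * X, Y, 5 * Z, 5 * W, by simpa using hne, ?_⟩
      rw [cubicNorm_smul, h]
      push_cast
      ring
    rcases eq_or_ne p 7 with rfl | h7
    · obtain rfl : hp = ⟨by norm_num⟩ := rfl
      obtain ⟨t, ht, -⟩ := exists_root_toZMod (p := 7) (-125) (-100) (-175) 7 4
        (by simp [map_ofNat]; decide) (by simp [map_ofNat]; decide)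
      refine ⟨7 * t, 1, 0, 0, by simp, ?_⟩
      unfold cubicNorm
      linear_combination 49 * ht
    rcases eq_or_ne p 7127 with rfl | h7127
    · obtain rfl : hp = ⟨by norm_num⟩ := rfl
      obtain ⟨X, Y, Z, W, hne, h⟩ := exists_padic_lift (p := 7127) 175 700 6125
        (x := 0) (y := 1) (z := 27) (w := 15) (by decide) (by decide) (by decide)
      exact hlift X Y Z W hne h
    obtain ⟨x, y, z, w, hne, h⟩ := exists_zmod_point p 175 700 6125
    obtain ⟨X, Y, Z, W, hne, h⟩ := exists_padic_lift (p := p) 175 700 6125 hne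
      (by push_cast; exact h) (fun hns => by
        push_cast at hns
        exact partials_zero_imp hroot (fun h0 => h5 (hcast 5 (by norm_num) (by exact_mod_cast h0)))
          (fun h0 => h7 (hcast 7 (by norm_num) (by exact_mod_cast h0)))
          (fun h0 => h2 (hcast 2 (by norm_num) (by exact_mod_cast h0)))
          (fun h0 => h7127 (hcast 7127 (by norm_num) (by exact_mod_cast h0)))
          hne h hns.1 hns.2.1 hns.2.2.1 hns.2.2.2)
    exact hlift X Y Z W hne h
  · unfold CubicRootless at hroot
    push Not at hroot
    obtain ⟨a, ha⟩ := hroot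
    suffices ∃ r : ℤ_[p], r ^ 3 + r + 1 = 0 by
      obtain ⟨r, hr⟩ := this
      exact exists_point_of_root hr
    by_cases h31 : (31 : ZMod p) = 0
    · obtain rfl : p = 31 := hcast 31 (by norm_num) (by exact_mod_cast h31)
      obtain rfl : hp = ⟨by norm_num⟩ := rfl
      obtain ⟨t, ht, -⟩ := exists_root_toZMod (p := 31) 1 1 0 1 3
        (by simp; decide) (by simp; decide)
      exact ⟨t, by linear_combination ht⟩
    · exact exists_padic_root ha h31

end LocalSolubility

section NormForm

lemma prod_eq_cubicNorm {φ : Fin 3 → ℂ} (hφ : ∀ i, φ i ^ 3 + φ i + 1 = 0)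
    (hinj : Function.Injective φ) (x z w : ℂ) :
    ∏ i : Fin 3, (x + φ i * z + φ i ^ 2 * w) = cubicNorm x z w := by
  have hne : ∀ i j, i ≠ j → φ i - φ j ≠ 0 := fun i j h => sub_ne_zero.2 (hinj.ne h)
  have e1 : ∀ i j, i ≠ j → φ i ^ 2 + φ i * φ j + φ j ^ 2 + 1 = 0 := fun i j h => by
    refine (mul_eq_zero.1 ?_).resolve_left (hne i j h)
    linear_combination hφ i - hφ j
  have h1 : φ 0 + φ 1 + φ 2 = 0 := by
    refine (mul_eq_zero.1 ?_).resolve_left (hne 1 2 (by decide))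
    linear_combination e1 0 1 (by decide) - e1 0 2 (by decide)
  have h0 : φ 0 = -φ 1 - φ 2 := by linear_combination h1
  have h12 := e1 1 2 (by decide)
  have h3 : φ 1 * φ 2 * (φ 1 + φ 2) = 1 := by linear_combination φ 1 * h12 - hφ 1
  rw [Fin.prod_univ_three, h0]
  unfold cubicNorm
  generalize φ 1 = a at *
  generalize φ 2 = b at *
  linear_combination (2 * x ^ 2 * w - x * z ^ 2 + (a ^ 2 + a * b + b ^ 2 - 1) * x * w ^ 2
    + z * w ^ 2) * h12 + (3 * x * z * w - z ^ 3 - z * w ^ 2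
    + (a ^ 2 + a * b + b ^ 2 + 1) * z * w ^ 2 + (a * b * (a + b) + 1) * w ^ 3) * h3

lemma aeval_eq_cubicNorm {φ : Fin 3 → ℂ} (hφ : ∀ i, φ i ^ 3 + φ i + 1 = 0)
    (hinj : Function.Injective φ) {N : MvPolynomial (Fin 3) ℚ}
    (hN : ∀ x z w : ℂ, MvPolynomial.aeval ![x, z, w] N
      = ∏ i : Fin 3, (x + φ i * z + φ i ^ 2 * w))
    {A : Type*} [CommRing A] [Algebra ℚ A] (x z w : A) :
    MvPolynomial.aeval ![x, z, w] N = cubicNorm x z w := by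
  have key : N = cubicNorm (MvPolynomial.X 0) (MvPolynomial.X 1) (MvPolynomial.X 2) := by
    apply MvPolynomial.map_injective (algebraMap ℚ ℂ) (algebraMap ℚ ℂ).injective
    refine MvPolynomial.funext fun v => ?_
    have hv : v = ![v 0, v 1, v 2] := by ext i; fin_cases i <;> rfl
    have h1 := hN (v 0) (v 1) (v 2)
    rw [← hv, prod_eq_cubicNorm hφ hinj, MvPolynomial.aeval_def, ← MvPolynomial.eval_map] at h1
    rw [h1, map_cubicNorm, map_cubicNorm]
    simp
  have h2 := map_cubicNorm (MvPolynomial.aeval (R := ℚ) ![x, z, w]).toRingHom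
    (MvPolynomial.X 0) (MvPolynomial.X 1) (MvPolynomial.X 2)
  rw [key]
  simpa using h2

end NormForm

/-- an example with two nonzero invariant summands: let `φ` be a root
of `t³ + t + 1 = 0`, `K₀ = ℚ(φ)`, `ψ = φ²`. The cubic surface
`N_{K₀/ℚ}(x + φ z + φ² w) = 5² · 7 · y (x + θ y)(x + θ̄ y)`, with `θ, θ̄` the roots of
`T² - 4T + 35` — i.e. `∏ᵢ (x + φᵢ z + φᵢ² w) = 175 y (x² + 4 x y + 35 y²)` over `ℚ` —
fails the Hasse principle: it has nontrivial points over `ℝ` and over `ℚ_p` for every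
prime `p`, but not over `ℚ`. Here `N` is the rational norm form, characterised by
`N(x, z, w) = ∏ᵢ (x + φᵢ z + φᵢ² w)` over `ℂ`. -/
theorem bsd_example_two_summands_fails_hasse_principle
    (φc : Fin 3 → ℂ) (hφc : ∀ i, (φc i) ^ 3 + φc i + 1 = 0)
    (hφinj : Function.Injective φc)
    (N : MvPolynomial (Fin 3) ℚ)
    (hN : ∀ x z w : ℂ, MvPolynomial.aeval ![x, z, w] N
        = ∏ i : Fin 3, (x + φc i * z + (φc i) ^ 2 * w)) :
    (∃ x y z w : ℝ, ¬(x = 0 ∧ y = 0 ∧ z = 0 ∧ w = 0) ∧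
        MvPolynomial.aeval ![x, z, w] N = 175 * y * (x ^ 2 + 4 * x * y + 35 * y ^ 2)) ∧
    (∀ (p : ℕ) [Fact p.Prime], ∃ x y z w : ℚ_[p], ¬(x = 0 ∧ y = 0 ∧ z = 0 ∧ w = 0) ∧
        MvPolynomial.aeval ![x, z, w] N = 175 * y * (x ^ 2 + 4 * x * y + 35 * y ^ 2)) ∧
    ¬(∃ x y z w : ℚ, ¬(x = 0 ∧ y = 0 ∧ z = 0 ∧ w = 0) ∧
        MvPolynomial.aeval ![x, z, w] N = 175 * y * (x ^ 2 + 4 * x * y + 35 * y ^ 2)) := by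
  refine ⟨?_, fun p _ => ?_, ?_⟩
  · obtain ⟨r, hr⟩ := exists_real_root
    obtain ⟨x, y, z, w, hne, h⟩ := exists_point_of_root hr
    exact ⟨x, y, z, w, hne, (aeval_eq_cubicNorm hφc hφinj hN x z w).trans h⟩
  · obtain ⟨x, y, z, w, hne, h⟩ := exists_padic_point p
    exact ⟨x, y, z, w, hne, (aeval_eq_cubicNorm hφc hφinj hN x z w).trans h⟩
  · rintro ⟨x, y, z, w, hne, h⟩
    exact no_rational_solution hne ((aeval_eq_cubicNorm hφc hφinj hN x z w).symm.trans h)
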